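/- Let r ≥ 6 be an integer that is not a prime power, and let N = (3r+1)(r−1). Then there exists a continuous map f : σ^N → ℝ^{3r} that has no r-Tverberg point. -/

import Mathlib

section TvPartA
open Set

/-! Part 1: reduction of the theorem to a statement on colored simplices -/

theorem tv_part1 {r : ℕ} (hr : 1 ≤ r) {C : Type} [Fintype C] [DecidableEq C]
    (h : (C → Fin r) → (C → ℝ) → ℂ × ℝ)
    (hc : ∀ a, ContinuousOn (h a) (stdSimplex ℝ C))
    (hs : ∀ a b, ∀ t ∈ stdSimplex ℝ C, (∀ c, t c ≠ 0 → a c = b c) → h a t = h b t)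
    (hn : ∀ π : C → Equiv.Perm (Fin r), ∀ t ∈ stdSimplex ℝ C,
      ∃ i j, h (fun c => π c i) t ≠ h (fun c => π c j) t) :
    ∃ g : (C × Fin r → ℝ) → ℂ × ℝ, Continuous g ∧
      ∀ x : Fin r → (C × Fin r → ℝ), (∀ i, x i ∈ stdSimplex ℝ (C × Fin r)) →
        (Pairwise fun i j => Disjoint {a | 0 < x i a} {a | 0 < x j a}) →
        (∀ i j c, ∑ l, x i (c, l) = ∑ l, x j (c, l)) → (∀ i j, g (x i) = g (x j)) → False := by
  classical
  haveI : Nonempty (Fin r) := ⟨⟨0, hr⟩⟩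
  let T : (C × Fin r → ℝ) → (C → ℝ) := fun x c => ∑ l, x (c, l)
  have hTc : Continuous T := by
    refine continuous_pi fun c => continuous_finsetSum _ fun l _ => continuous_apply _
  have hT : ∀ x ∈ stdSimplex ℝ (C × Fin r), T x ∈ stdSimplex ℝ C := by
    intro x hx
    refine ⟨fun c => Finset.sum_nonneg fun l _ => hx.1 _, ?_⟩
    rw [← hx.2, Fintype.sum_prod_type]
  let K : (C → Fin r) → Set (C × Fin r → ℝ) := fun a =>
    stdSimplex ℝ (C × Fin r) ∩ {x | ∀ c l, l ≠ a c → x (c, l) = 0}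
  have hKcl : ∀ a, IsClosed (K a) := by
    intro a
    refine (isClosed_stdSimplex _ _).inter ?_
    simp only [setOf_forall]
    refine isClosed_iInter fun c => isClosed_iInter fun l => isClosed_iInter fun _ =>
      isClosed_eq (continuous_apply _) continuous_const
  let A : (C × Fin r → ℝ) → C → Fin r := fun x c =>
    if hx : ∃ l, x (c, l) ≠ 0 then hx.choose else Classical.arbitrary _
  have hA : ∀ x a, x ∈ K a → h (A x) (T x) = h a (T x) := by
    intro x a hx
    refine hs _ _ _ (hT x hx.1) fun c hc => ?_
    obtain ⟨l, -, hl⟩ := Finset.exists_ne_zero_of_sum_ne_zero hc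
    have hex : ∃ l, x (c, l) ≠ 0 := ⟨l, hl⟩
    have h1 : x (c, A x c) ≠ 0 := by
      simp only [A, dif_pos hex]
      exact hex.choose_spec
    by_contra hne
    exact h1 (hx.2 c _ hne)
  have hcont : ContinuousOn (fun x => h (A x) (T x)) (⋃ a, K a) := by
    refine (locallyFinite_of_finite K).continuousOn_iUnion hKcl fun a => ?_
    have : ContinuousOn (fun x => h a (T x)) (K a) :=
      (hc a).comp hTc.continuousOn fun x hx => hT x hx.1
    exact this.congr fun x hx => hA x a hx
  have hcl : IsClosed (⋃ a, K a) := isClosed_iUnion_of_finite hKcl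
  obtain ⟨g, hg⟩ := ContinuousMap.exists_restrict_eq hcl
    ⟨(⋃ a, K a).restrict (fun x => h (A x) (T x)), continuousOn_iff_continuous_restrict.1 hcont⟩
  have hg' : ∀ a, ∀ x ∈ K a, g x = h a (T x) := by
    intro a x hx
    have := DFunLike.congr_fun hg (⟨x, mem_iUnion.2 ⟨a, hx⟩⟩ : (⋃ a, K a))
    simp at this
    rw [this]
    exact hA x a hx
  refine ⟨g, g.continuous, ?_⟩
  intro x hx hd ht hgx
  let i0 : Fin r := ⟨0, hr⟩
  have key : ∀ c, ∃ p : Equiv.Perm (Fin r), ∀ i l, l ≠ p i → x i (c, l) = 0 := by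
    intro c
    have hd' : ∀ i j v, i ≠ j → 0 < x i v → 0 < x j v → False := fun i j v hij h1 h2 =>
      Set.disjoint_left.1 (hd hij) h1 h2
    by_cases h0 : ∑ l, x i0 (c, l) = 0
    · refine ⟨1, fun i l _ => ?_⟩
      rw [ht i0 i] at h0
      exact (Finset.sum_eq_zero_iff_of_nonneg (fun l _ => (hx i).1 _)).1 h0 l (Finset.mem_univ _)
    · have : ∀ i, ∃ l, 0 < x i (c, l) := by
        intro i
        rw [ht i0 i] at h0
        obtain ⟨l, -, hl⟩ := Finset.exists_ne_zero_of_sum_ne_zero h0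
        exact ⟨l, lt_of_le_of_ne ((hx i).1 _) (Ne.symm hl)⟩
      choose p hp using this
      have hinj : Function.Injective p := by
        intro i j hij
        by_contra hne
        have h2 := hp j
        rw [← hij] at h2
        exact hd' i j _ hne (hp i) h2
      have hbij := Finite.injective_iff_bijective.1 hinj
      refine ⟨Equiv.ofBijective p hbij, fun i l hl => ?_⟩
      obtain ⟨j, rfl⟩ := hbij.2 l
      by_contra hne
      have hpos : 0 < x i (c, p j) := lt_of_le_of_ne ((hx i).1 _) (Ne.symm hne)
      have hij : i ≠ j := by
        rintro rfl; exact hl rfl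
      exact hd' i j _ hij hpos (hp j)
  choose π hπ using key
  have hTx : ∀ i, T (x i) = T (x i0) := fun i => funext fun c => ht i i0 c
  obtain ⟨i, j, hij⟩ := hn π (T (x i0)) (hT _ (hx i0))
  apply hij
  have e : ∀ i, g (x i) = h (fun c => π c i) (T (x i0)) := by
    intro i
    rw [← hTx i]
    exact hg' _ _ ⟨hx i, fun c l hl => hπ c i l hl⟩
  rw [← e i, ← e j, hgx]

theorem tv_reduction (r : ℕ) (hr : 6 ≤ r)
    (hcore : ∃ h : (Fin (3 * r - 3 + 1) → Fin r) → (Fin (3 * r - 3 + 1) → ℝ) → ℂ × ℝ,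
      (∀ a, ContinuousOn (h a) (stdSimplex ℝ (Fin (3 * r - 3 + 1)))) ∧
      (∀ a b, ∀ t ∈ stdSimplex ℝ (Fin (3 * r - 3 + 1)),
        (∀ c, t c ≠ 0 → a c = b c) → h a t = h b t) ∧
      (∀ π : Fin (3 * r - 3 + 1) → Equiv.Perm (Fin r),
        ∀ t ∈ stdSimplex ℝ (Fin (3 * r - 3 + 1)),
        ∃ i j, h (fun c => π c i) t ≠ h (fun c => π c j) t))
    (N : ℕ) (hN : N = (3 * r + 1) * (r - 1)) :
    ∃ f : (Fin (N + 1) → ℝ) → EuclideanSpace ℝ (Fin (3 * r)),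
      ContinuousOn f (stdSimplex ℝ (Fin (N + 1))) ∧
      ¬ ∃ x : Fin r → (Fin (N + 1) → ℝ),
          (∀ i, x i ∈ stdSimplex ℝ (Fin (N + 1))) ∧
          (Pairwise fun i j => Disjoint {a | 0 < x i a} {a | 0 < x j a}) ∧
          (∀ i j, f (x i) = f (x j)) := by
  obtain ⟨h, hc, hs, hn⟩ := hcore
  obtain ⟨g, hg, hg2⟩ := tv_part1 (by omega) h hc hs hn
  have hcard : Fintype.card (Fin (N + 1)) = Fintype.card (Fin (3 * r - 3 + 1) × Fin r) := by
    obtain ⟨s, rfl⟩ : ∃ s, r = s + 1 := ⟨r - 1, by omega⟩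
    simp only [Fintype.card_fin, Fintype.card_prod, hN]
    have : 3 * (s + 1) - 3 = 3 * s := by omega
    rw [this]
    simp only [Nat.add_sub_cancel]
    ring
  let e : Fin (N + 1) ≃ Fin (3 * r - 3 + 1) × Fin r := Fintype.equivOfCardEq hcard
  have hfr : Module.finrank ℝ ((Fin (3 * r - 3) → ℝ) × (ℂ × ℝ)) =
      Module.finrank ℝ (EuclideanSpace ℝ (Fin (3 * r))) := by
    simp [Module.finrank_prod]
    omega
  let L := ContinuousLinearEquiv.ofFinrankEq hfr
  refine ⟨fun x => L (fun c => ∑ l, x (e.symm (c.succ, l)), g (x ∘ e.symm)), ?_, ?_⟩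
  · refine Continuous.continuousOn (L.continuous.comp (Continuous.prodMk ?_ (hg.comp ?_)))
    · exact continuous_pi fun c => continuous_finsetSum _ fun l _ => continuous_apply _
    · exact continuous_pi fun c => continuous_apply _
  · rintro ⟨x, hx, hd, hf⟩
    have hf' := fun i j => Prod.ext_iff.1 (L.injective (hf i j))
    simp only at hf'
    have hsx : ∀ i, ∑ c, ∑ l, x i (e.symm (c, l)) = 1 := by
      intro i
      rw [← (hx i).2, ← Fintype.sum_prod_type', ← e.symm.sum_comp]
    refine hg2 (fun i => x i ∘ e.symm) (fun i => ⟨fun v => (hx i).1 _, ?_⟩) ?_ ?_ ?_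
    · rw [Fintype.sum_prod_type]; exact hsx i
    · intro i j hij
      rw [Set.disjoint_left]
      intro v h1 h2
      exact Set.disjoint_left.1 (hd hij) h1 h2
    · intro i j c
      have hsucc : ∀ c : Fin (3 * r - 3), ∑ l, x i (e.symm (c.succ, l)) =
        ∑ l, x j (e.symm (c.succ, l)) := fun c => congrFun (hf' i j).1 c
      refine Fin.cases ?_ hsucc c
      have h1 := hsx i
      have h2 := hsx j
      rw [Fin.sum_univ_succ] at h1 h2
      have h3 := Finset.sum_congr (rfl : (Finset.univ : Finset (Fin (3 * r - 3))) = _)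
        (fun c _ => hsucc c)
      simp only [Function.comp]
      linarith
    · intro i j
      exact (hf' i j).2

end TvPartA

section TvPartB
open Set

/-! Part 2: general position -/

abbrev TvE := ℂ × ℝ

theorem tv_small {V : Type} [NormedAddCommGroup V] [NormedSpace ℝ V] [FiniteDimensional ℝ V]
    {D : Type} [NormedAddCommGroup D] [NormedSpace ℝ D] [FiniteDimensional ℝ D]
    (F : D → V) (hF : ContDiff ℝ 1 F) (hd : Module.finrank ℝ D < Module.finrank ℝ V)
    (S : Set V) (hS : S ⊆ range F) : dimH S < Module.finrank ℝ V :=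
  lt_of_le_of_lt ((dimH_mono hS).trans hF.dimH_range_le) (by exact_mod_cast hd)

theorem tv_dense {V : Type} [NormedAddCommGroup V] [NormedSpace ℝ V] [FiniteDimensional ℝ V]
    {ι : Type} [Finite ι] (S : ι → Set V) (hV : 0 < Module.finrank ℝ V)
    (hS : ∀ i, dimH (S i) < Module.finrank ℝ V) :
    Dense (⋃ i, S i)ᶜ := by
  classical
  have := Fintype.ofFinite ι
  apply dense_compl_of_dimH_lt_finrank
  rw [dimH_iUnion, ← Finset.sup_univ_eq_iSup, Finset.sup_lt_iff (by rw [bot_eq_zero]; exact_mod_cast hV)]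
  exact fun i _ => hS i

theorem tv_part2 {C : Type} [Fintype C] [DecidableEq C] {r : ℕ} (hC : Fintype.card C + 1 < 3 * r)
    (hC2 : 2 ≤ Fintype.card C) (e1 : TvE) :
    ∃ w : C × Fin r → TvE, ∀ (π : C → Equiv.Perm (Fin r)) (J : Finset (Fin r)) (τ : Option C → ℝ)
      (κ : TvE) (c1 : C) (o1 o2 : Option C), τ (some c1) ≠ 0 → o1 ≠ o2 → τ o1 = 0 → τ o2 = 0 →
      ¬ ∀ i, ∑ c, τ (some c) • w (c, π c i) = κ + (if i ∈ J then τ none else 0) • e1 := by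
  classical
  let I := (C → Equiv.Perm (Fin r)) × Finset (Fin r) × C × Option C × Option C
  let S : I → Set (C × Fin r → TvE) := fun p => {w | p.2.2.2.1 ≠ p.2.2.2.2 ∧ ∃ τ : Option C → ℝ,
    ∃ κ : TvE, τ (some p.2.2.1) ≠ 0 ∧ τ p.2.2.2.1 = 0 ∧ τ p.2.2.2.2 = 0 ∧
      ∀ i, ∑ c, τ (some c) • w (c, p.1 c i) = κ + (if i ∈ p.2.1 then τ none else 0) • e1}
  have hr : 0 < r := by omega
  have hfV : Module.finrank ℝ (C × Fin r → TvE) = Fintype.card C * r * 3 := by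
    simp [Module.finrank_pi_fintype, Module.finrank_prod]
  have hpos : 0 < Fintype.card C * r * 3 := by positivity
  have hS : ∀ p, dimH (S p) < Module.finrank ℝ (C × Fin r → TvE) := by
    rintro ⟨π, J, c1, o1, o2⟩
    by_cases hne : o1 ≠ o2 ∧ o1 ≠ some c1 ∧ o2 ≠ some c1
    swap
    · have : S ⟨π, J, c1, o1, o2⟩ = ∅ := by
        ext w
        simp only [S, mem_ofPred_eq, mem_empty_iff_false, iff_false]
        rintro ⟨h1, τ, κ, h2, h3, h4, -⟩
        apply hne
        refine ⟨h1, ?_, ?_⟩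
        · rintro rfl; exact h2 h3
        · rintro rfl; exact h2 h4
      rw [this, dimH_empty, hfV]
      exact_mod_cast hpos
    obtain ⟨h12, h1, h2⟩ := hne
    let Q : Option C → Prop := fun o => o ≠ some c1 ∧ o ≠ o1 ∧ o ≠ o2
    let D := ({o // Q o} → ℝ) × TvE × ({v : C × Fin r // v.1 ≠ c1} → TvE)
    let ext : ({o // Q o} → ℝ) → Option C → ℝ := fun u o => if h : Q o then u ⟨o, h⟩ else 0
    let extw : ({v : C × Fin r // v.1 ≠ c1} → TvE) → C × Fin r → TvE :=
      fun u o => if h : o.1 ≠ c1 then u ⟨o, h⟩ else 0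
    let F : D → (C × Fin r → TvE) := fun d v =>
      if v.1 = c1 then d.2.1 + (if (π c1).symm v.2 ∈ J then ext d.1 none else 0) • e1
        - ∑ c, ext d.1 (some c) • extw d.2.2 (c, π c ((π c1).symm v.2))
      else extw d.2.2 v
    refine tv_small F ?_ ?_ _ ?_
    · have hext : ∀ o, ContDiff ℝ 1 (fun d : D => ext d.1 o) := by
        intro o
        simp only [ext]
        split_ifs with h
        · exact (contDiff_apply ℝ ℝ (⟨o, h⟩ : {o // Q o})).comp contDiff_fst
        · exact contDiff_const
      have hextw : ∀ o, ContDiff ℝ 1 (fun d : D => extw d.2.2 o) := by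
        intro o
        simp only [extw]
        split_ifs with h
        · exact (contDiff_apply ℝ TvE (⟨o, h⟩ : {v : C × Fin r // v.1 ≠ c1})).comp
            (contDiff_snd.comp contDiff_snd)
        · exact contDiff_const
      rw [contDiff_pi]
      intro v
      simp only [F]
      split_ifs with hv hJ
      · refine ContDiff.sub ?_ (ContDiff.sum fun c _ => (hext _).smul (hextw _))
        exact (contDiff_fst.comp contDiff_snd).add ((hext none).smul contDiff_const)
      · refine ContDiff.sub ?_ (ContDiff.sum fun c _ => (hext _).smul (hextw _))
        exact (contDiff_fst.comp contDiff_snd).add contDiff_const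
      · exact hextw v
    · have e1' : Fintype.card {o // Q o} + 3 = Fintype.card C + 1 := by
        have : (Finset.univ.filter Q) = Finset.univ \ {some c1, o1, o2} := by
          ext o; simp [Q]
        rw [Fintype.card_subtype, this, Finset.card_sdiff_of_subset (Finset.subset_univ _),
          Finset.card_univ, Fintype.card_option, Finset.card_eq_three.2
            ⟨_, _, _, h1.symm, h2.symm, h12, rfl⟩]
        omega
      have e2 : Fintype.card {v : C × Fin r // v.1 ≠ c1} = (Fintype.card C - 1) * r := by
        have : (Finset.univ.filter fun v : C × Fin r => v.1 ≠ c1)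
          = (Finset.univ.erase c1) ×ˢ Finset.univ := by
          ext o; simp
        rw [Fintype.card_subtype, this, Finset.card_product, Finset.card_erase_of_mem
          (Finset.mem_univ _)]
        simp
      rw [hfV]
      have : Module.finrank ℝ D = Fintype.card {o // Q o} + (3 +
        Fintype.card {v : C × Fin r // v.1 ≠ c1} * 3) := by
        simp [D, Module.finrank_pi_fintype, Module.finrank_prod]
      rw [this, e2]
      obtain ⟨s, hs⟩ : ∃ s, Fintype.card C = s + 1 := ⟨Fintype.card C - 1, by omega⟩
      rw [hs] at *
      simp only [Nat.add_sub_cancel]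
      nlinarith
    · rintro w ⟨-, τ, κ, ht1, ht2, ht3, hw⟩
      simp only at ht1 ht2 ht3 hw
      set s := τ (some c1) with hsdef
      refine ⟨⟨fun o => s⁻¹ * τ o.1, s⁻¹ • κ, fun v => w v.1⟩, ?_⟩
      have hx1 : ∀ o, o ≠ some c1 → ext (fun o => s⁻¹ * τ o.1) o = s⁻¹ * τ o := by
        intro o ho
        simp only [ext]
        split_ifs with h
        · rfl
        · have : o = o1 ∨ o = o2 := by
            simp only [Q] at h; tauto
          rcases this with rfl | rfl
          · simp [ht2]
          · simp [ht3]
      have hx2 : ext (fun o => s⁻¹ * τ o.1) (some c1) = 0 := by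
        simp [ext, Q]
      have hx3 : ∀ v : C × Fin r, v.1 ≠ c1 → extw (fun v => w v.1) v = w v := by
        intro v hv; simp [extw, hv]
      funext v
      obtain ⟨c, l⟩ := v
      simp only [F]
      split_ifs with hv hJ
      · subst hv
        have := hw ((π c).symm l)
        rw [← Finset.add_sum_erase _ _ (Finset.mem_univ c)] at this
        rw [← Finset.add_sum_erase _ _ (Finset.mem_univ c), hx2, zero_smul, zero_add]
        have hsum : ∑ x ∈ Finset.univ.erase c, ext (fun o => s⁻¹ * τ o.1) (some x) •
            extw (fun v => w v.1) (x, π x ((π c).symm l)) =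
            s⁻¹ • ∑ x ∈ Finset.univ.erase c, τ (some x) • w (x, π x ((π c).symm l)) := by
          rw [Finset.smul_sum]
          refine Finset.sum_congr rfl fun x hx => ?_
          have hxc : x ≠ c := Finset.ne_of_mem_erase hx
          rw [hx1 _ (by simpa using hxc), hx3 _ hxc, mul_smul]
        rw [hsum, hx1 _ (by simp)]
        simp only [hJ, if_true, Equiv.apply_symm_apply] at this
        rw [mul_smul, ← smul_add, ← smul_sub, ← this, add_sub_cancel_right, ← hsdef,
          smul_smul, inv_mul_cancel₀ ht1, one_smul]
      · subst hv
        have := hw ((π c).symm l)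
        rw [← Finset.add_sum_erase _ _ (Finset.mem_univ c)] at this
        rw [← Finset.add_sum_erase _ _ (Finset.mem_univ c), hx2]
        simp only [zero_smul, zero_add]
        have hsum : ∑ x ∈ Finset.univ.erase c, ext (fun o => s⁻¹ * τ o.1) (some x) •
            extw (fun v => w v.1) (x, π x ((π c).symm l)) =
            s⁻¹ • ∑ x ∈ Finset.univ.erase c, τ (some x) • w (x, π x ((π c).symm l)) := by
          rw [Finset.smul_sum]
          refine Finset.sum_congr rfl fun x hx => ?_
          have hxc : x ≠ c := Finset.ne_of_mem_erase hx
          rw [hx1 _ (by simpa using hxc), hx3 _ hxc, mul_smul]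
        rw [hsum]
        simp only [hJ, if_false, Equiv.apply_symm_apply, zero_smul, add_zero] at this ⊢
        rw [← smul_sub, ← this, add_sub_cancel_right, ← hsdef,
          smul_smul, inv_mul_cancel₀ ht1, one_smul]
      · exact hx3 _ hv
  obtain ⟨w, hw⟩ := (tv_dense S (by rw [hfV]; exact hpos) hS).nonempty
  refine ⟨w, fun π J τ κ c1 o1 o2 h1 h2 h3 h4 h5 => hw ?_⟩
  exact mem_iUnion.2 ⟨⟨π, J, c1, o1, o2⟩, h2, τ, κ, h1, h3, h4, h5⟩

end TvPartB

section TvPartC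
open Set

/-! Part 4: the combination lemma -/

/-- non-constant tuples -/
def TvNC {r : ℕ} (x : Fin r → TvE) : Prop := ∃ i j, x i ≠ x j

/-- size of the non-constancy of a tuple -/
noncomputable def tvN {r : ℕ} (x : Fin r → TvE) : ℝ := ‖fun p : Fin r × Fin r => x p.1 - x p.2‖

theorem tvN_nonneg {r : ℕ} (x : Fin r → TvE) : 0 ≤ tvN x := norm_nonneg _

theorem tvN_pos {r : ℕ} {x : Fin r → TvE} : 0 < tvN x ↔ TvNC x := by
  rw [tvN, norm_pos_iff, TvNC, ne_eq, funext_iff]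
  simp [sub_eq_zero]

theorem tvN_continuous {r : ℕ} : Continuous (tvN : (Fin r → TvE) → ℝ) := by
  unfold tvN; fun_prop

theorem tvN_sub_le {r : ℕ} (x y : Fin r → TvE) : tvN x - 2 * ‖x - y‖ ≤ tvN y := by
  have h1 : tvN x - tvN y ≤ ‖(fun p : Fin r × Fin r => x p.1 - x p.2) -
    (fun p : Fin r × Fin r => y p.1 - y p.2)‖ := norm_sub_norm_le _ _
  have h2 : ‖(fun p : Fin r × Fin r => x p.1 - x p.2) -
    (fun p : Fin r × Fin r => y p.1 - y p.2)‖ ≤ 2 * ‖x - y‖ := by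
    rw [pi_norm_le_iff_of_nonneg (by positivity)]
    intro p
    have e : ((fun p : Fin r × Fin r => x p.1 - x p.2) -
      (fun p : Fin r × Fin r => y p.1 - y p.2)) p = (x - y) p.1 - (x - y) p.2 := by
      simp only [Pi.sub_apply]; abel
    rw [e]
    have := norm_sub_le ((x - y) p.1) ((x - y) p.2)
    have := norm_le_pi_norm (x - y) p.1
    have := norm_le_pi_norm (x - y) p.2
    linarith
  linarith

theorem tvNC_of_close {r : ℕ} {x y : Fin r → TvE} (h : 2 * ‖x - y‖ < tvN x) : TvNC y := by
  rw [← tvN_pos]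
  have := tvN_sub_le x y
  linarith

/-- maps with non-constant values and with prescribed values on `Bd` -/
def TvP {r : ℕ} {X : Type} [TopologicalSpace X] (Bd : Set X) (b : X → Fin r → TvE)
    (h : C(X, Fin r → TvE)) : Prop := (∀ x, TvNC (h x)) ∧ ∀ x ∈ Bd, h x = b x

theorem tv_homotopic {r : ℕ} {X : Type} [TopologicalSpace X] (Bd : Set X) (b : X → Fin r → TvE)
    (f g : C(X, Fin r → TvE)) (H : ℝ × X → Fin r → TvE) (hH : Continuous H)
    (h0 : ∀ x, H (0, x) = f x) (h1 : ∀ x, H (1, x) = g x)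
    (hn : ∀ s ∈ Icc (0 : ℝ) 1, ∀ x, TvNC (H (s, x)))
    (hb : ∀ s ∈ Icc (0 : ℝ) 1, ∀ x ∈ Bd, H (s, x) = b x) :
    ContinuousMap.HomotopicWith f g (TvP Bd b) := by
  refine ⟨⟨⟨⟨fun p => H (p.1, p.2), by fun_prop⟩, ?_, ?_⟩, ?_⟩⟩
  · intro x; simp [h0]
  · intro x; simp [h1]
  · intro s
    exact ⟨fun x => hn s s.2 x, fun x hx => hb s s.2 x hx⟩

/-- reindexing -/
noncomputable def tvPre {r : ℕ} {X A : Type} [TopologicalSpace X] (l : Fin r → A) (y : C(X, A → TvE)) :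
    C(X, Fin r → TvE) := ⟨fun x i => y x (l i), by fun_prop⟩

theorem tv_exists_lower {X : Type} [TopologicalSpace X] [CompactSpace X] (f : X → ℝ)
    (hf : Continuous f) (hpos : ∀ x, 0 < f x) : ∃ δ > 0, ∀ x, δ ≤ f x := by
  rcases isEmpty_or_nonempty X with h | h
  · exact ⟨1, one_pos, fun x => (h.false x).elim⟩
  · obtain ⟨x, -, hx⟩ := isCompact_univ.exists_isMinOn univ_nonempty hf.continuousOn
    exact ⟨f x, hpos x, fun y => hx (mem_univ y)⟩

theorem tv_smooth_approx {X W F : Type} [TopologicalSpace X] [CompactSpace X]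
    [NormedAddCommGroup W] [NormedSpace ℝ W] [FiniteDimensional ℝ W]
    [NormedAddCommGroup F] [NormedSpace ℝ F] [TietzeExtension.{0, 0} F]
    (ι : X → W) (hι : Continuous ι) (hinj : Function.Injective ι) (f : C(X, F)) (ε : ℝ)
    (hε : 0 < ε) : ∃ P : W → F, ContDiff ℝ 1 P ∧ ∀ x, ‖P (ι x) - f x‖ < ε := by
  obtain ⟨g, hg⟩ := ContinuousMap.exists_extension' (hι.isClosedEmbedding hinj) f
  obtain ⟨P, hP, hP2, -⟩ := g.continuous.exists_contDiff_approx 1 (ε := fun _ => ε)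
    continuous_const (fun _ => hε)
  refine ⟨P, hP, fun x => ?_⟩
  rw [← dist_eq_norm, ← congrFun hg x]
  exact hP2 _

theorem tv_generic_v {W A : Type} [NormedAddCommGroup W] [NormedSpace ℝ W] [FiniteDimensional ℝ W]
    [Fintype A] [DecidableEq A] {r : ℕ} (hW : Module.finrank ℝ W + 1 < 3 * r)
    (L : Fin r → A) (hL : Function.Injective L) (P : W → A → TvE) (hP : ContDiff ℝ 1 P)
    (Q : W → Fin r → TvE) (hQ : ContDiff ℝ 1 Q) (b b' : A) (hbb : b ≠ b')
    (hb : b ∉ range L) (hb' : b' ∉ range L) :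
    dimH {v : A → TvE | ∃ w : W, ∃ σ : ℝ, ∃ κ : TvE,
      (∀ i, P w (L i) + v (L i) + σ • Q w i = κ) ∧ P w b + v b = P w b' + v b'} <
      Module.finrank ℝ (A → TvE) := by
  classical
  let Z := {a // a ∉ range L ∧ a ≠ b}
  let D := W × ℝ × TvE × (Z → TvE)
  let F : D → A → TvE := fun d a =>
    if h : ∃ i, L i = a then d.2.2.1 - P d.1 a - d.2.1 • Q d.1 h.choose
    else if h2 : a = b then P d.1 b' + d.2.2.2 ⟨b', hb', hbb.symm⟩ - P d.1 b
    else d.2.2.2 ⟨a, h, h2⟩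
  refine tv_small F ?_ ?_ _ ?_
  · have hPa : ∀ a, ContDiff ℝ 1 (fun d : D => P d.1 a) := fun a =>
      (contDiff_pi.1 hP a).comp contDiff_fst
    have hQa : ∀ a, ContDiff ℝ 1 (fun d : D => Q d.1 a) := fun a =>
      (contDiff_pi.1 hQ a).comp contDiff_fst
    have hv : ∀ z : Z, ContDiff ℝ 1 (fun d : D => d.2.2.2 z) := fun z =>
      (contDiff_apply ℝ TvE z).comp (contDiff_snd.comp (contDiff_snd.comp contDiff_snd))
    rw [contDiff_pi]
    intro a
    simp only [F]
    split_ifs with h h2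
    · refine ContDiff.sub (ContDiff.sub ?_ (hPa _)) (ContDiff.smul (f := fun x : D => x.2.1) ?_ (hQa h.choose))
      · exact contDiff_fst.comp (contDiff_snd.comp contDiff_snd)
      · exact contDiff_fst.comp contDiff_snd
    · exact ((hPa _).add (hv _)).sub (hPa _)
    · exact hv _
  · have hcard : Fintype.card Z + r + 1 = Fintype.card A := by
      have e : (Finset.univ.filter fun a => a ∉ range L ∧ a ≠ b) =
        Finset.univ \ (insert b (Finset.univ.image L)) := by
        ext a; simp; tauto
      have hc : (insert b (Finset.univ.image L)).card = r + 1 := by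
        rw [Finset.card_insert_of_notMem (by simpa using hb), Finset.card_image_of_injective _ hL]
        simp
      have hle := Finset.card_le_univ (insert b (Finset.univ.image L))
      rw [Fintype.card_subtype, e, Finset.card_sdiff_of_subset (Finset.subset_univ _),
        Finset.card_univ, hc]
      omega
    have h1 : Module.finrank ℝ D = Module.finrank ℝ W + (1 + (3 + Fintype.card Z * 3)) := by
      simp [D, Module.finrank_pi_fintype, Module.finrank_prod]
    have h2 : Module.finrank ℝ (A → TvE) = Fintype.card A * 3 := by
      simp [Module.finrank_pi_fintype, Module.finrank_prod]
    rw [h1, h2]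
    omega
  · rintro v ⟨w, σ, κ, h1, h2⟩
    refine ⟨⟨w, σ, κ, fun z => v z.1⟩, ?_⟩
    funext a
    simp only [F]
    split_ifs with h h3
    · have := h1 h.choose
      rw [h.choose_spec] at this
      rw [← this]
      abel
    · subst h3
      rw [← h2]; abel
    · rfl

end TvPartC

section TvPartD
open Set Filter Topology

theorem tv_finite_lower {ι : Type} [Finite ι] (d : ι → ℝ) (hd : ∀ i, 0 < d i) :
    ∃ δ > 0, ∀ i, δ ≤ d i := by
  have h : ∀ᶠ δ in 𝓝[>] (0 : ℝ), 0 < δ ∧ ∀ i, δ ≤ d i := by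
    refine Filter.Eventually.and (eventually_mem_nhdsWithin) (eventually_all.2 fun i => ?_)
    filter_upwards [Ioc_mem_nhdsGT (hd i)] with δ hδ using hδ.2
  obtain ⟨δ, h1, h2⟩ := h.exists
  exact ⟨δ, h1, h2⟩

theorem tv_step {X W A Pp : Type} [TopologicalSpace X] [CompactSpace X] [T2Space X]
    [NormedAddCommGroup W] [NormedSpace ℝ W] [FiniteDimensional ℝ W]
    [Fintype A] [DecidableEq A] [Finite Pp] {r : ℕ} (hW : Module.finrank ℝ W + 1 < 3 * r)
    (ι : X → W) (hι : Continuous ι) (hinj : Function.Injective ι) (Bd : Set X) (hBd : IsClosed Bd)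
    (l : Pp → Fin r → A) (L : Fin r → A) (hL : Function.Injective L)
    (hl : ∀ p, ∃ j j', l p j ≠ l p j' ∧ l p j ∉ range L ∧ l p j' ∉ range L)
    (y : C(X, A → TvE)) (hy : ∀ p x, TvNC (tvPre (l p) y x))
    (G : C(X, Fin r → TvE)) (hG : ∀ x, TvNC (G x)) (hGb : ∀ x ∈ Bd, G x = tvPre L y x) :
    ∃ y' : C(X, A → TvE), (∀ x ∈ Bd, y' x = y x) ∧
      (∀ p, ContinuousMap.HomotopicWith (tvPre (l p) y') (tvPre (l p) y)
        (TvP Bd (tvPre (l p) y))) ∧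
      ContinuousMap.HomotopicWith (tvPre L y') G (TvP Bd G) := by
  classical
  -- lower bounds
  have h1 : ∀ p : Option Pp, ∃ δ > 0, ∀ x, δ ≤
      (match p with | none => tvN (G x) | some p => tvN (tvPre (l p) y x)) := by
    intro p
    match p with
    | none =>
      exact tv_exists_lower _ (tvN_continuous.comp G.continuous) fun x => tvN_pos.2 (hG x)
    | some p =>
      exact tv_exists_lower _ (tvN_continuous.comp (tvPre (l p) y).continuous)
        fun x => tvN_pos.2 (hy p x)
  choose d hd hd2 using h1
  obtain ⟨δ, hδ, hδd⟩ := tv_finite_lower d hd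
  have hδG : ∀ x, δ ≤ tvN (G x) := fun x => (hδd none).trans (hd2 none x)
  have hδy : ∀ p x, δ ≤ tvN (tvPre (l p) y x) := fun p x => (hδd (some p)).trans (hd2 (some p) x)
  -- the neighbourhood of the boundary
  let Ω : Set X := {x | ‖tvPre L y x - G x‖ < δ / 8}
  have hΩo : IsOpen Ω := isOpen_lt (by fun_prop) continuous_const
  have hBΩ : Bd ⊆ Ω := by
    intro x hx
    change ‖tvPre L y x - G x‖ < δ / 8
    rw [hGb x hx, sub_self, norm_zero]
    positivity
  obtain ⟨ρ, hρ0, hρ1, hρI⟩ := exists_continuous_zero_one_of_isClosed hBd hΩo.isClosed_compl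
    (disjoint_compl_right_iff_subset.2 hBΩ)
  set ε := δ / 32 with hε
  have hεpos : 0 < ε := by positivity
  obtain ⟨P, hP, hPy⟩ := tv_smooth_approx ι hι hinj y (ε / 2) (by positivity)
  obtain ⟨Q, hQ, hQG⟩ := tv_smooth_approx ι hι hinj G ε (by positivity)
  choose j j' hjj hj hj' using hl
  -- generic translation
  let S : Pp → Set (A → TvE) := fun p => {v : A → TvE | ∃ w : W, ∃ σ : ℝ, ∃ κ : TvE,
      (∀ i, P w (L i) + v (L i) + σ • Q w i = κ) ∧
        P w (l p (j p)) + v (l p (j p)) = P w (l p (j' p)) + v (l p (j' p))}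
  have hr : 0 < r := by omega
  have hV : 0 < Module.finrank ℝ (A → TvE) := by
    have : 0 < Fintype.card A := Fintype.card_pos_iff.2 ⟨L ⟨0, hr⟩⟩
    have h2 : Module.finrank ℝ (A → TvE) = Fintype.card A * 3 := by
      simp [Module.finrank_pi_fintype, Module.finrank_prod]
    omega
  obtain ⟨v, hvS, hv⟩ : ∃ v, v ∈ (⋃ p, S p)ᶜ ∧ ‖v‖ < ε / 2 := by
    have hdense := tv_dense S hV fun p =>
      tv_generic_v hW L hL P hP Q hQ _ _ (hjj p) (hj p) (hj' p)
    obtain ⟨v, hv1, hv2⟩ := hdense.exists_mem_open (Metric.isOpen_ball (x := (0 : A → TvE))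
      (ε := ε / 2)) ⟨0, by simpa using hεpos⟩
    exact ⟨v, hv1, by simpa using hv2⟩
  let q : X → A → TvE := fun x a => ρ x • (P (ι x) a + v a - y x a)
  let qG : X → Fin r → TvE := fun x i => ρ x • (Q (ι x) i - G x i)
  have hPc := hP.continuous
  have hQc := hQ.continuous
  have hqc : Continuous q := by fun_prop
  have hqGc : Continuous qG := by fun_prop
  have hρn : ∀ x, ‖ρ x‖ ≤ 1 := fun x => by
    rw [Real.norm_eq_abs, abs_of_nonneg (hρI x).1]; exact (hρI x).2
  have hq : ∀ x a, ‖q x a‖ ≤ ε := by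
    intro x a
    have h1 := norm_le_pi_norm (P (ι x) - y x) a
    have h2 := norm_le_pi_norm v a
    have h3 := hPy x
    have h4 : ‖P (ι x) a + v a - y x a‖ ≤ ε := by
      have e : P (ι x) a + v a - y x a = (P (ι x) - y x) a + v a := by
        simp only [Pi.sub_apply]; abel
      rw [e]
      have := norm_add_le ((P (ι x) - y x) a) (v a)
      linarith
    rw [norm_smul]
    calc ‖ρ x‖ * ‖P (ι x) a + v a - y x a‖ ≤ 1 * ε :=
          mul_le_mul (hρn x) h4 (norm_nonneg _) zero_le_one
      _ = ε := one_mul _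
  have hqG : ∀ x a, ‖qG x a‖ ≤ ε := by
    intro x a
    have h1 := norm_le_pi_norm (Q (ι x) - G x) a
    have h3 := hQG x
    rw [norm_smul]
    calc ‖ρ x‖ * ‖Q (ι x) a - G x a‖ ≤ 1 * ε :=
          mul_le_mul (hρn x) (h1.trans h3.le) (norm_nonneg _) zero_le_one
      _ = ε := one_mul _
  have hqB : ∀ x ∈ Bd, ∀ a, q x a = 0 := by
    intro x hx a
    simp [q, hρ0 hx]
  have hqGB : ∀ x ∈ Bd, ∀ a, qG x a = 0 := by
    intro x hx a
    simp [qG, hρ0 hx]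
  let yt : X → A → TvE := fun x a => y x a + q x a
  let Gt : X → Fin r → TvE := fun x i => G x i + qG x i
  have hytc : Continuous yt := by fun_prop
  have hGtc : Continuous Gt := by fun_prop
  -- non-constancy of straight line perturbations
  have hyNC : ∀ p x, ∀ s ∈ Icc (0 : ℝ) 1, TvNC (fun i => y x (l p i) + s • q x (l p i)) := by
    intro p x s hs
    refine tvNC_of_close (x := tvPre (l p) y x) (lt_of_lt_of_le ?_ (hδy p x))
    have : ‖(tvPre (l p) y x) - (fun i => y x (l p i) + s • q x (l p i))‖ ≤ ε := by
      rw [pi_norm_le_iff_of_nonneg hεpos.le]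
      intro i
      have e : ((tvPre (l p) y x) - (fun i => y x (l p i) + s • q x (l p i))) i =
        -(s • q x (l p i)) := by simp [tvPre]
      rw [e, norm_neg, norm_smul, Real.norm_eq_abs, abs_of_nonneg hs.1]
      nlinarith [hq x (l p i), norm_nonneg (q x (l p i)), hs.2, hs.1]
    linarith
  have hGNC : ∀ x, ∀ s ∈ Icc (0 : ℝ) 1, TvNC (fun i => G x i + s • qG x i) := by
    intro x s hs
    refine tvNC_of_close (x := G x) (lt_of_lt_of_le ?_ (hδG x))
    have : ‖(G x) - (fun i => G x i + s • qG x i)‖ ≤ ε := by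
      rw [pi_norm_le_iff_of_nonneg hεpos.le]
      intro i
      have e : ((G x) - (fun i => G x i + s • qG x i)) i =
        -(s • qG x i) := by simp
      rw [e, norm_neg, norm_smul, Real.norm_eq_abs, abs_of_nonneg hs.1]
      nlinarith [hqG x i, norm_nonneg (qG x i), hs.2, hs.1]
    linarith
  have hytNC : ∀ p x, TvNC (fun i => yt x (l p i)) := fun p x => by
    have := hyNC p x 1 ⟨zero_le_one, le_rfl⟩
    simpa [yt] using this
  have hGtNC : ∀ x, TvNC (Gt x) := fun x => by
    have := hGNC x 1 ⟨zero_le_one, le_rfl⟩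
    simpa [Gt] using this
  let Θ : ℝ → X → Fin r → TvE := fun s x i => (1 - s) • yt x (L i) + s • Gt x i
  have hΘc : Continuous fun p : ℝ × X => Θ p.1 p.2 := by fun_prop
  have hΘ1 : ∀ x, Θ 1 x = Gt x := by intro x; funext i; simp [Θ]
  have hΘΩ : ∀ x ∈ Ω, ∀ s ∈ Icc (0 : ℝ) 1, TvNC (Θ s x) := by
    intro x hx s hs
    refine tvNC_of_close (x := G x) (lt_of_lt_of_le ?_ (hδG x))
    have : ‖G x - Θ s x‖ ≤ δ / 8 + ε := by
      rw [pi_norm_le_iff_of_nonneg (by positivity)]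
      intro i
      have e : (G x - Θ s x) i = -((1 - s) • ((tvPre L y x - G x) i + q x (L i))
        + s • qG x i) := by
        simp only [Θ, yt, Gt, tvPre, Pi.sub_apply, ContinuousMap.coe_mk]
        module
      rw [e, norm_neg]
      have h1 := norm_add_le ((1 - s) • ((tvPre L y x - G x) i + q x (L i))) (s • qG x i)
      rw [norm_smul, norm_smul, Real.norm_eq_abs, Real.norm_eq_abs, abs_of_nonneg hs.1,
        abs_of_nonneg (sub_nonneg.2 hs.2)] at h1
      have h2 := norm_add_le ((tvPre L y x - G x) i) (q x (L i))
      have h3 := norm_le_pi_norm (tvPre L y x - G x) i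
      have h4 : ‖tvPre L y x - G x‖ < δ / 8 := hx
      have h5 := hq x (L i)
      have h6 := hqG x i
      have h7 : ‖(tvPre L y x - G x) i + q x (L i)‖ ≤ δ / 8 + ε := by linarith
      have h8 := mul_le_mul_of_nonneg_left h7 (sub_nonneg.2 hs.2)
      have h9 := mul_le_mul_of_nonneg_left h6 hs.1
      have h10 : 0 ≤ s * (δ / 8) := mul_nonneg hs.1 (by positivity)
      nlinarith
    linarith
  -- the bad sets
  let Wb : Set X := Prod.snd '' {p : ℝ × X | p.1 ∈ Icc (0 : ℝ) 1 ∧ tvN (Θ p.1 p.2) = 0}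
  have hWcl : IsClosed Wb := by
    have hc : IsCompact {p : ℝ × X | p.1 ∈ Icc (0 : ℝ) 1 ∧ tvN (Θ p.1 p.2) = 0} := by
      refine (isCompact_Icc.prod (isCompact_univ (X := X))).of_isClosed_subset (s := Icc (0 : ℝ) 1 ×ˢ univ)
        ?_ fun p hp => ⟨hp.1, mem_univ _⟩
      exact (isClosed_Icc.preimage continuous_fst).inter
        (isClosed_eq (tvN_continuous.comp hΘc) continuous_const)
    exact (hc.image continuous_snd).isClosed
  have hWb : ∀ x, ∀ s ∈ Icc (0 : ℝ) 1, x ∉ Wb → TvNC (Θ s x) := by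
    intro x s hs hx
    rw [← tvN_pos]
    refine lt_of_le_of_ne (tvN_nonneg _) fun h => hx ⟨(s, x), ⟨hs, h.symm⟩, rfl⟩
  let B : Set X := ⋃ p, {x | yt x (l p (j p)) = yt x (l p (j' p))}
  have hBcl : IsClosed B := isClosed_iUnion_of_finite fun p =>
    isClosed_eq (by fun_prop) (by fun_prop)
  have hdisj : Disjoint (B ∪ Bd) Wb := by
    rw [Set.disjoint_left]
    rintro x hx ⟨⟨s, x'⟩, ⟨hs, hs0⟩, rfl⟩
    simp only at hs hs0 hx
    have hconst : ¬ TvNC (Θ s x') := by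
      rw [← tvN_pos, hs0]; exact lt_irrefl _
    have hxΩ : x' ∉ Ω := fun h => hconst (hΘΩ x' h s hs)
    rcases hx with hx | hx
    swap
    · exact hxΩ (hBΩ hx)
    obtain ⟨p, hp⟩ := mem_iUnion.1 hx
    have hρx : ρ x' = 1 := hρ1 hxΩ
    have hyt : ∀ a, yt x' a = P (ι x') a + v a := by
      intro a; simp [yt, q, hρx]
    have hGt : ∀ i, Gt x' i = Q (ι x') i := by
      intro i; simp [Gt, qG, hρx]
    have hs1 : s ≠ 1 := by
      rintro rfl
      rw [hΘ1] at hconst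
      exact hconst (hGtNC x')
    have hs1' : 1 - s ≠ 0 := sub_ne_zero.2 (Ne.symm hs1)
    apply hvS
    refine mem_iUnion.2 ⟨p, ι x', s / (1 - s), (1 - s)⁻¹ • Θ s x' ⟨0, hr⟩, fun i => ?_, ?_⟩
    · have : Θ s x' i = Θ s x' ⟨0, hr⟩ := by
        by_contra hne
        exact hconst ⟨_, _, hne⟩
      rw [← this]
      simp only [Θ, hyt, hGt]
      rw [smul_add, smul_smul, smul_smul, inv_mul_cancel₀ hs1', one_smul, div_eq_inv_mul]
    · have h := hp
      simp only [mem_ofPred_eq, hyt] at h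
      exact h
  obtain ⟨θ, hθ0, hθ1, hθI⟩ := exists_continuous_zero_one_of_isClosed (hBcl.union hBd) hWcl hdisj
  let Y : ℝ → X → A → TvE := fun u x a =>
    if h : ∃ i, L i = a then Θ u x h.choose else yt x a
  have hYc : Continuous fun p : ℝ × X => Y p.1 p.2 := by
    refine continuous_pi fun a => ?_
    simp only [Y]
    split_ifs with h
    · exact (continuous_apply h.choose).comp hΘc
    · fun_prop
  have hYL : ∀ u x i, Y u x (L i) = Θ u x i := by
    intro u x i
    have h : ∃ i', L i' = L i := ⟨i, rfl⟩
    simp only [Y, dif_pos h]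
    rw [hL h.choose_spec]
  have hYn : ∀ u x a, a ∉ range L → Y u x a = yt x a := by
    intro u x a ha
    have h : ¬ ∃ i', L i' = a := ha
    simp only [Y, dif_neg h]
  have hY0 : ∀ x, Y 0 x = yt x := by
    intro x
    funext a
    by_cases ha : a ∈ range L
    · obtain ⟨i, rfl⟩ := ha
      rw [hYL]; simp [Θ]
    · exact hYn _ _ _ ha
  have hθB : ∀ x ∈ Bd, θ x = 0 := fun x hx => hθ0 (Or.inr hx)
  have hytB : ∀ x ∈ Bd, yt x = y x := fun x hx => by
    funext a; simp [yt, hqB x hx]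
  have hGtB : ∀ x ∈ Bd, Gt x = G x := fun x hx => by
    funext a; simp [Gt, hqGB x hx]
  have hYp : ∀ p x u, TvNC (fun i => Y (u * θ x) x (l p i)) := by
    intro p x u
    by_contra hcon
    have hx : x ∈ B := by
      refine mem_iUnion.2 ⟨p, ?_⟩
      by_contra hne
      refine hcon ⟨j p, j' p, ?_⟩
      simp only [hYn _ _ _ (hj p), hYn _ _ _ (hj' p)]
      exact hne
    have : θ x = 0 := hθ0 (Or.inl hx)
    rw [this, mul_zero, hY0] at hcon
    exact hcon (hytNC p x)
  have hYL' : ∀ x, ∀ s ∈ Icc (0 : ℝ) 1, TvNC (Θ (max (θ x) s) x) := by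
    intro x s hs
    by_cases hx : x ∈ Wb
    · have : θ x = 1 := hθ1 hx
      rw [this, max_eq_left hs.2, hΘ1]
      exact hGtNC x
    · exact hWb x _ ⟨(hθI x).1.trans (le_max_left _ _), max_le (hθI x).2 hs.2⟩ hx
  let y' : C(X, A → TvE) := ⟨fun x => Y (θ x) x, hYc.comp (θ.continuous.prodMk continuous_id)⟩
  have hΘB : ∀ x ∈ Bd, ∀ s, Θ s x = G x := by
    intro x hx s
    funext i
    simp only [Θ, hytB x hx, hGtB x hx, hGb x hx, tvPre, ContinuousMap.coe_mk]
    module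
  refine ⟨y', fun x hx => ?_, fun p => ?_, ?_⟩
  · change Y (θ x) x = y x
    rw [hθB x hx, hY0, hytB x hx]
  · let m : C(X, Fin r → TvE) := ⟨fun x i => yt x (l p i), by fun_prop⟩
    refine ContinuousMap.HomotopicWith.trans (g := m) ?_ ?_
    · refine tv_homotopic Bd _ _ _ (fun z i => Y ((1 - z.1) * θ z.2) z.2 (l p i)) ?_ ?_ ?_ ?_ ?_
      · have h5 : Continuous fun z : ℝ × X => ((1 - z.1) * θ z.2, z.2) := by fun_prop
        exact continuous_pi fun i => (continuous_apply (l p i)).comp (hYc.comp h5)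
      · intro x; simp [y', tvPre]
      · intro x; simp [m, hY0]
      · intro s hs x; exact hYp p x _
      · intro s hs x hx
        funext i
        simp only [hθB x hx, mul_zero, hY0, hytB x hx]
        rfl
    · refine tv_homotopic Bd _ _ _ (fun z i => y z.2 (l p i) + (1 - z.1) • q z.2 (l p i))
        (by fun_prop) ?_ ?_ ?_ ?_
      · intro x; simp [m, yt]
      · intro x; simp [tvPre]
      · intro s hs x; exact hyNC p x _ ⟨by linarith [hs.2], by linarith [hs.1]⟩
      · intro s hs x hx
        funext i
        simp [hqB x hx, tvPre]
  · let m : C(X, Fin r → TvE) := ⟨Gt, hGtc⟩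
    refine ContinuousMap.HomotopicWith.trans (g := m) ?_ ?_
    · refine tv_homotopic Bd _ _ _ (fun z => Θ (max (θ z.2) z.1) z.2) ?_ ?_ ?_ ?_ ?_
      · have h5 : Continuous fun z : ℝ × X => (max (θ z.2) z.1, z.2) := by fun_prop
        exact hΘc.comp h5
      · intro x
        funext i
        simp only [max_eq_left (hθI x).1]
        exact (hYL _ _ _).symm
      · intro x
        simp only [max_eq_right (hθI x).2, hΘ1]
        rfl
      · intro s hs x; exact hYL' x s hs
      · intro s hs x hx
        exact hΘB x hx _
    · refine tv_homotopic Bd _ _ _ (fun z i => G z.2 i + (1 - z.1) • qG z.2 i)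
        (by fun_prop) ?_ ?_ ?_ ?_
      · intro x; simp [m, Gt]
      · intro x; simp
      · intro s hs x; exact hGNC x _ ⟨by linarith [hs.2], by linarith [hs.1]⟩
      · intro s hs x hx
        funext i
        simp [hqGB x hx]

theorem tv_combination {X W A Pp : Type} [TopologicalSpace X] [CompactSpace X] [T2Space X]
    [NormedAddCommGroup W] [NormedSpace ℝ W] [FiniteDimensional ℝ W]
    [Fintype A] [DecidableEq A] [Fintype Pp] {r : ℕ} (hW : Module.finrank ℝ W + 1 < 3 * r)
    (ι : X → W) (hι : Continuous ι) (hinj : Function.Injective ι) (Bd : Set X) (hBd : IsClosed Bd)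
    (l : Pp → Fin r → A) (hL : ∀ p, Function.Injective (l p))
    (hl : ∀ p q, p ≠ q → ∃ j j', l p j ≠ l p j' ∧ l p j ∉ range (l q) ∧ l p j' ∉ range (l q))
    (y : C(X, A → TvE)) (G : Pp → C(X, Fin r → TvE)) (hG : ∀ p x, TvNC (G p x))
    (hGb : ∀ p, ∀ x ∈ Bd, G p x = tvPre (l p) y x) :
    ∃ y' : C(X, A → TvE), (∀ x ∈ Bd, y' x = y x) ∧
      (∀ p, ContinuousMap.HomotopicWith (tvPre (l p) y') (G p) (TvP Bd (G p))) := by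
  classical
  suffices h : ∀ T : Finset Pp, ∃ y' : C(X, A → TvE), (∀ x ∈ Bd, y' x = y x) ∧
      (∀ p ∈ T, ContinuousMap.HomotopicWith (tvPre (l p) y') (G p) (TvP Bd (G p))) by
    obtain ⟨y', h1, h2⟩ := h Finset.univ
    exact ⟨y', h1, fun p => h2 p (Finset.mem_univ p)⟩
  intro T
  induction T using Finset.induction_on with
  | empty => exact ⟨y, fun _ _ => rfl, by simp⟩
  | insert p0 T hp0 ih =>
    obtain ⟨y1, hy1, hT⟩ := ih
    obtain ⟨y2, hy2, h3, h4⟩ := tv_step (Pp := {p // p ∈ T}) hW ι hι hinj Bd hBd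
      (fun p => l p.1) (l p0) (hL p0)
      (fun p => hl p.1 p0 (fun h => hp0 (h ▸ p.2))) y1
      (fun p x => by
        obtain ⟨F⟩ := hT p.1 p.2
        have := (F.prop' 0).1 x
        simpa using this) (G p0) (hG p0)
      (fun x hx => by
        rw [hGb p0 x hx]
        funext i
        simp [tvPre, hy1 x hx])
    refine ⟨y2, fun x hx => (hy2 x hx).trans (hy1 x hx), fun p hp => ?_⟩
    rcases Finset.mem_insert.1 hp with rfl | hp
    · exact h4
    · refine ContinuousMap.HomotopicWith.trans ?_ (hT p hp)
      obtain ⟨F⟩ := h3 ⟨p, hp⟩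
      refine ⟨⟨F.toHomotopy, fun t => ⟨(F.prop' t).1, fun x hx => ((F.prop' t).2 x hx).trans ?_⟩⟩⟩
      rw [hGb p x hx]
      funext i
      simp [tvPre, hy1 x hx]

end TvPartD

section TvPartH
open Set Filter Topology

/-- homotopy extension -/
theorem tv_hep {X : Type} [TopologicalSpace X] [CompactSpace X] [T2Space X] {r : ℕ}
    (Bd : Set X) (hBd : IsClosed Bd) (f : C(Bd, Fin r → TvE)) (c : Fin r → TvE)
    (b : Bd → Fin r → TvE)
    (h : ContinuousMap.HomotopicWith f (ContinuousMap.const _ c) (TvP ∅ b)) (hc : TvNC c) :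
    ∃ g : C(X, Fin r → TvE), (∀ x, TvNC (g x)) ∧ ∀ x : Bd, g x = f x := by
  classical
  obtain ⟨F⟩ := h
  have hemb : IsClosedEmbedding (fun p : unitInterval × Bd => (p.1, (p.2 : X))) :=
    IsClosedEmbedding.id.prodMap hBd.isClosedEmbedding_subtypeVal
  obtain ⟨F', hF'⟩ := ContinuousMap.exists_extension' hemb F.toContinuousMap
  have hF1 : ∀ s (x : Bd), F' (s, (x : X)) = F.toContinuousMap (s, x) := fun s x =>
    congrFun hF' (s, x)
  let Z : Set X := Prod.snd '' {p : unitInterval × X | tvN (F' p) = 0}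
  have hZ : IsClosed Z := by
    have hcl : IsClosed {p : unitInterval × X | tvN (F' p) = 0} :=
      isClosed_eq (tvN_continuous.comp F'.continuous) continuous_const
    exact (hcl.isCompact.image continuous_snd).isClosed
  let O : Set X := Zᶜ ∩ {x | 2 * ‖c - F' (1, x)‖ < tvN c}
  have hO : IsOpen O := hZ.isOpen_compl.inter (isOpen_lt (by fun_prop) continuous_const)
  have hBO : Bd ⊆ O := by
    intro x hx
    constructor
    · rintro ⟨⟨s, x'⟩, hs, rfl⟩
      simp only at hx
      have h1 := hF1 s ⟨x', hx⟩
      have h2 := (F.prop' s).1 ⟨x', hx⟩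
      have hs' : tvN (F' (s, x')) = 0 := hs
      rw [h1] at hs'
      have h3 := tvN_pos.2 h2
      exact absurd hs' h3.ne'
    · have h1 := hF1 1 ⟨x, hx⟩
      have h2 := F.map_one_left ⟨x, hx⟩
      have h3 : F' (1, x) = c := by
        rw [h1]; exact h2
      change 2 * ‖c - F' (1, x)‖ < tvN c
      rw [h3, sub_self, norm_zero, mul_zero]
      exact tvN_pos.2 hc
  obtain ⟨u, hu0, hu1, huI⟩ := exists_continuous_zero_one_of_isClosed hBd hO.isClosed_compl
    (disjoint_compl_right_iff_subset.2 hBO)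
  let k : X → unitInterval := fun x => projIcc 0 1 zero_le_one (2 * u x)
  have hk : Continuous k := continuous_projIcc.comp (by fun_prop)
  refine ⟨⟨fun x => F' (k x, x) + max (2 * u x - 1) 0 • (c - F' (1, x)), by fun_prop⟩, ?_, ?_⟩
  · intro x
    simp only [ContinuousMap.coe_mk]
    rcases le_total (2 * u x) 1 with h | h
    · have hx : x ∈ O := by
        by_contra hx
        have : u x = 1 := hu1 hx
        linarith
      rw [max_eq_right (by linarith), zero_smul, add_zero, ← tvN_pos]
      exact lt_of_le_of_ne (tvN_nonneg _) fun h => hx.1 ⟨(k x, x), h.symm, rfl⟩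
    · have hk1 : k x = 1 := projIcc_of_right_le _ h
      rw [max_eq_left (by linarith), hk1]
      by_cases hx : x ∈ O
      · refine tvNC_of_close (x := c) (lt_of_le_of_lt ?_ hx.2)
        have e : c - (F' (1, x) + (2 * u x - 1) • (c - F' (1, x))) =
          (1 - (2 * u x - 1)) • (c - F' (1, x)) := by module
        rw [e, norm_smul, Real.norm_eq_abs, abs_of_nonneg (by linarith [(huI x).2])]
        nlinarith [norm_nonneg (c - F' (1, x))]
      · have : u x = 1 := hu1 hx
        rw [this]
        norm_num
        exact hc
  · intro x
    have hux : u x = 0 := hu0 x.2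
    have hk0 : k x = 0 := projIcc_of_le_left _ (by rw [hux]; simp)
    simp only [ContinuousMap.coe_mk, hux, hk0]
    rw [hF1]
    have := F.map_zero_left x
    norm_num

end TvPartH

section TvPartI
open Set Filter Topology

/-- proper nonempty subsets -/
def tvJ (r : ℕ) : Finset (Finset (Fin r)) :=
  Finset.univ.filter fun J => J.Nonempty ∧ J ≠ Finset.univ

theorem mem_tvJ {r : ℕ} {J : Finset (Fin r)} : J ∈ tvJ r ↔ J.Nonempty ∧ J ≠ Finset.univ := by
  simp [tvJ]

theorem tv_weights {r : ℕ} (hr : 2 ≤ r) (hnp : ¬ IsPrimePow r) :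
    ∃ w : ℕ → ℤ, ∑ J ∈ tvJ r, w J.card = -1 := by
  classical
  have h1 := Choose.gcd_choose_eq_one_of_not_isPrimePow (by omega : 1 < r) hnp
  obtain ⟨f, hf⟩ := Finset.gcd_eq_sum_mul (Finset.Icc 1 (r - 1)) (fun j => (r.choose j : ℤ))
  set g := (Finset.Icc 1 (r - 1)).gcd (fun j => (r.choose j : ℤ)) with hg
  have hg1 : g.natAbs = 1 := by
    rw [← Nat.dvd_one, ← h1, Finset.dvd_gcd_iff]
    intro j hj
    have : g ∣ (r.choose j : ℤ) := Finset.gcd_dvd hj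
    exact Int.natCast_dvd_natCast.1 (Int.natAbs_dvd.2 this)
  have hgg : g * g = 1 := by
    rcases Int.natAbs_eq_iff.1 hg1 with h | h <;> rw [h] <;> norm_num
  have key : ∀ w : ℕ → ℤ, ∑ J ∈ tvJ r, w J.card = ∑ j ∈ Finset.Icc 1 (r - 1), r.choose j * w j := by
    intro w
    have hm : ∀ J ∈ tvJ r, J.card ∈ Finset.Icc 1 (r - 1) := by
      intro J hJ
      rw [mem_tvJ] at hJ
      have h2 : 0 < J.card := hJ.1.card_pos
      have h3 : J.card < r := by
        have := (Finset.card_lt_iff_ne_univ J).2 hJ.2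
        simpa using this
      rw [Finset.mem_Icc]; omega
    rw [← Finset.sum_fiberwise_of_maps_to hm]
    refine Finset.sum_congr rfl fun j hj => ?_
    have e : (tvJ r).filter (fun J => J.card = j) = Finset.powersetCard j Finset.univ := by
      ext J
      rw [Finset.mem_filter, mem_tvJ, Finset.mem_powersetCard]
      rw [Finset.mem_Icc] at hj
      constructor
      · rintro ⟨-, h⟩; exact ⟨Finset.subset_univ _, h⟩
      · rintro ⟨-, h⟩
        refine ⟨⟨Finset.card_pos.1 (by omega), ?_⟩, h⟩
        rintro rfl
        rw [Finset.card_univ, Fintype.card_fin] at h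
        omega
    rw [e, Finset.sum_congr rfl (g := fun _ => w j)]
    · simp
    · intro J hJ
      rw [(Finset.mem_powersetCard.1 hJ).2]
  refine ⟨fun j => -g * f j, ?_⟩
  rw [key (fun j => -g * f j)]
  have : ∑ j ∈ Finset.Icc 1 (r - 1), (r.choose j : ℤ) * (-g * f j) =
      -g * ∑ j ∈ Finset.Icc 1 (r - 1), f j * (r.choose j : ℤ) := by
    rw [Finset.mul_sum]
    refine Finset.sum_congr rfl fun j _ => by ring
  rw [this]
  have h5 : ∑ j ∈ Finset.Icc 1 (r - 1), f j * (r.choose j : ℤ) = g := by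
    rw [hf]
    refine Finset.sum_congr rfl fun j _ => by ring
  rw [h5]
  linarith

theorem tv_functional {r : ℕ} (hr : 2 ≤ r) :
    ∃ a : Fin r → ℂ, ∑ k, a k = 0 ∧ (∀ J ∈ tvJ r, ∑ k ∈ J, a k ≠ 0) ∧
      ∀ J ∈ tvJ r, ∀ J' ∈ tvJ r, J ≠ J' → ∀ β : ℝ, 0 < β →
        ∑ k ∈ J, a k ≠ β * ∑ k ∈ J', a k := by
  classical
  let o : Fin r := ⟨0, by omega⟩
  let e : Finset (Fin r) → Fin r → ℝ := fun J k =>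
    (if k ∈ J then 1 else 0) - (if o ∈ J then 1 else 0)
  let A : (Fin r → ℝ) →ₗ[ℝ] ℝ := ∑ k, LinearMap.proj k
  have hA : ∀ v, A v = ∑ k, v k := fun v => by simp [A]
  -- sign structure
  have hpos : ∀ J ∈ tvJ r, o ∉ J → (∀ k, 0 ≤ e J k) ∧ ∃ k, 0 < e J k := by
    intro J hJ ho
    obtain ⟨k, hk⟩ := (mem_tvJ.1 hJ).1
    refine ⟨fun k => ?_, k, by simp [e, hk, ho]⟩
    simp only [e, ho, if_false]; split_ifs <;> norm_num
  have hneg : ∀ J ∈ tvJ r, o ∈ J → (∀ k, e J k ≤ 0) ∧ ∃ k, e J k < 0 := by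
    intro J hJ ho
    have : ∃ k, k ∉ J := by
      by_contra h; push Not at h
      exact (mem_tvJ.1 hJ).2 (Finset.eq_univ_iff_forall.2 h)
    obtain ⟨k, hk⟩ := this
    refine ⟨fun k => ?_, k, by simp [e, hk, ho]⟩
    simp only [e, ho, if_true]; split_ifs <;> norm_num
  have hA0 : ∀ J ∈ tvJ r, A (e J) ≠ 0 := by
    intro J hJ
    rw [hA]
    by_cases ho : o ∈ J
    · obtain ⟨h1, k, hk⟩ := hneg J hJ ho
      exact (Finset.sum_neg' (fun k _ => h1 k) ⟨k, Finset.mem_univ _, hk⟩).ne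
    · obtain ⟨h1, k, hk⟩ := hpos J hJ ho
      exact (Finset.sum_pos' (fun k _ => h1 k) ⟨k, Finset.mem_univ _, hk⟩).ne'
  let v : Finset (Fin r) × Finset (Fin r) → Fin r → ℝ := fun p => A (e p.2) • e p.1 - A (e p.1) • e p.2
  obtain ⟨B, hB⟩ := Module.exists_dual_forall_apply_ne_zero (K := ℝ)
    (fun p : {p // v p ≠ 0} => v p.1) (fun p => p.2)
  let d : Fin r → Fin r → ℝ := fun k => Pi.single k 1 - (if k = o then (fun _ => (1:ℝ)) else 0 : Fin r → ℝ)
  have hd : ∀ J, ∑ k ∈ J, d k = e J := by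
    intro J
    funext m
    simp only [d, Finset.sum_apply, Finset.sum_sub_distrib, e, Pi.sub_apply]
    congr 1
    · simp [Pi.single_apply]
    · have : ∀ c, (if c = o then (fun _ => (1 : ℝ)) else 0 : Fin r → ℝ) m = if c = o then 1 else 0 := by
        intro c; split_ifs <;> rfl
      simp [this]
  let a : Fin r → ℂ := fun k => (A (d k) : ℂ) + (B (d k) : ℂ) * Complex.I
  have ha : ∀ J, ∑ k ∈ J, a k = (A (e J) : ℂ) + (B (e J) : ℂ) * Complex.I := by
    intro J
    rw [← hd J]
    simp only [a, Finset.sum_add_distrib, map_sum, Finset.sum_mul, Complex.ofReal_sum]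
  have hre : ∀ J, (∑ k ∈ J, a k).re = A (e J) := fun J => by rw [ha]; simp
  have him : ∀ J, (∑ k ∈ J, a k).im = B (e J) := fun J => by rw [ha]; simp
  refine ⟨a, ?_, ?_, ?_⟩
  · have : e Finset.univ = 0 := by funext k; simp [e]
    rw [ha, this]; simp
  · intro J hJ h0
    apply hA0 J hJ
    rw [← hre, h0, Complex.zero_re]
  · intro J hJ J' hJ' hne β hβ heq
    have h1 := congrArg Complex.re heq
    have h2 := congrArg Complex.im heq
    rw [Complex.re_ofReal_mul, hre, hre] at h1
    rw [Complex.im_ofReal_mul, him, him] at h2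
    have hv : v (J, J') = 0 := by
      by_contra hv
      apply hB ⟨(J, J'), hv⟩
      simp only [v, map_sub, map_smul, h1, h2, smul_eq_mul]
      ring
    have hev : ∀ k, e J k = β * e J' k := by
      intro k
      have := congrFun hv k
      simp only [v, Pi.sub_apply, Pi.smul_apply, smul_eq_mul, h1, Pi.zero_apply] at this
      have h3 : A (e J') * (e J k - β * e J' k) = 0 := by linarith
      rcases mul_eq_zero.1 h3 with h | h
      · exact absurd h (hA0 J' hJ')
      · linarith
    apply hne
    by_cases ho : o ∈ J <;> by_cases ho' : o ∈ J'
    · ext k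
      have := hev k
      simp only [e, ho, ho', if_true] at this
      by_cases hk : k ∈ J <;> by_cases hk' : k ∈ J' <;> simp [hk, hk'] at this ⊢
      · exact hβ.ne' this
    · exfalso
      obtain ⟨h1, k, hk⟩ := hneg J hJ ho
      have := (hpos J' hJ' ho').1 k
      rw [hev k] at hk
      nlinarith
    · exfalso
      obtain ⟨h1, k, hk⟩ := hpos J hJ ho
      have := (hneg J' hJ' ho').1 k
      rw [hev k] at hk
      nlinarith
    · ext k
      have := hev k
      simp only [e, ho, ho', if_false] at this
      by_cases hk : k ∈ J <;> by_cases hk' : k ∈ J' <;> simp [hk, hk'] at this ⊢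
      · exact hβ.ne' this.symm

end TvPartI

section TvPartK
open Set Filter Topology

/-! Part 3a: the planar construction -/

noncomputable def tvS (η : ℝ) (z : ℂ) : ℝ := max (η * z.re - |z.im|) 0

noncomputable def tvp (η : ℝ) (z : ℂ) : ℂ :=
  ((‖z‖ - 2 / η * tvS η z : ℝ) : ℂ) - ((z.im * tvS η z : ℝ) : ℂ) * Complex.I

noncomputable def tvnz (q : ℂ) : ℂ := q / (‖q‖ : ℂ)

theorem tvS_cont (η : ℝ) : Continuous (tvS η) := by
  unfold tvS
  fun_prop

theorem tvp_cont (η : ℝ) : Continuous (tvp η) := by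
  unfold tvp
  have := tvS_cont η
  fun_prop

theorem tvp_re (η : ℝ) (z : ℂ) : (tvp η z).re = ‖z‖ - 2 / η * tvS η z := by
  simp [tvp]

theorem tvp_im (η : ℝ) (z : ℂ) : (tvp η z).im = - (z.im * tvS η z) := by
  simp [tvp]

theorem tvp_of_not {η : ℝ} {z : ℂ} (h : tvS η z = 0) : tvp η z = (‖z‖ : ℂ) := by
  simp [tvp, h]

theorem tvS_nonneg (η : ℝ) (z : ℂ) : 0 ≤ tvS η z := le_max_right _ _

theorem tvS_pos {η : ℝ} {z : ℂ} : 0 < tvS η z ↔ |z.im| < η * z.re := by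
  unfold tvS
  rw [lt_max_iff]
  constructor
  · rintro (h | h)
    · linarith
    · exact absurd h (lt_irrefl _)
  · intro h; left; linarith

theorem tvS_zero (η : ℝ) : tvS η 0 = 0 := by simp [tvS]

theorem tvp_key {η : ℝ} (hη : 0 < η) {z : ℂ} {s : ℝ} (hs : s ∈ Icc (0 : ℝ) 1)
    (h : (1 - s : ℝ) * tvp η z - (s : ℝ) * z = 0) : z = 0 := by
  obtain ⟨h0, h1⟩ := hs
  have hre := congrArg Complex.re h
  have him := congrArg Complex.im h
  rw [Complex.sub_re, Complex.re_ofReal_mul, Complex.re_ofReal_mul, tvp_re, Complex.zero_re] at hre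
  rw [Complex.sub_im, Complex.im_ofReal_mul, Complex.im_ofReal_mul, tvp_im, Complex.zero_im] at him
  have hS := tvS_nonneg η z
  rcases hS.eq_or_lt with h2 | h2
  · rw [← h2] at hre him
    simp only [mul_zero, neg_zero, sub_zero, zero_sub] at hre him
    by_contra hz
    have hz' : 0 < ‖z‖ := norm_pos_iff.2 hz
    rcases h0.eq_or_lt with h3 | h3
    · rw [← h3] at hre; simp at hre; exact hz hre
    · have him0 : z.im = 0 := by
        have : s * z.im = 0 := by linarith
        rcases mul_eq_zero.1 this with h | h
        · linarith
        · exact h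
      have hre0 : 0 ≤ z.re := by
        by_contra hneg
        push Not at hneg
        nlinarith [mul_nonneg (sub_nonneg.2 h1) hz'.le]
      have h4 : ¬ 0 < tvS η z := by rw [← h2]; exact lt_irrefl _
      rw [tvS_pos, him0, abs_zero, not_lt] at h4
      apply hz
      apply Complex.ext
      · rw [Complex.zero_re]
        nlinarith
      · simpa using him0
  · have hpos := tvS_pos.1 h2
    have hrepos : 0 < z.re := by
      have := abs_nonneg z.im
      by_contra hneg
      push Not at hneg
      nlinarith
    have him0 : z.im = 0 := by
      have : z.im * ((1 - s) * tvS η z + s) = 0 := by linarith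
      rcases mul_eq_zero.1 this with h | h
      · exact h
      · exfalso
        have h5 : 0 ≤ (1 - s) * tvS η z := mul_nonneg (sub_nonneg.2 h1) h2.le
        have h6 : s = 0 := by linarith
        rw [h6] at h; simp at h; linarith
    exfalso
    have hSz : tvS η z = η * z.re := by
      unfold tvS
      rw [him0, abs_zero, sub_zero, max_eq_left]
      positivity
    have hn : ‖z‖ = z.re := by
      have : z = (z.re : ℂ) := Complex.ext (by simp) (by simpa using him0)
      rw [this, Complex.norm_real, Complex.ofReal_re, Real.norm_of_nonneg hrepos.le]
    rw [hSz, hn] at hre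
    have : 2 / η * (η * z.re) = 2 * z.re := by field_simp
    rw [this] at hre
    nlinarith

theorem tvnz_norm {q : ℂ} (h : q ≠ 0) : ‖tvnz q‖ = 1 := by
  unfold tvnz
  rw [norm_div, Complex.norm_real, norm_norm, div_self (norm_ne_zero_iff.2 h)]

theorem tvnz_zpow_norm {q : ℂ} (h : q ≠ 0) (w : ℤ) : ‖tvnz q ^ w‖ = 1 := by
  rw [norm_zpow, tvnz_norm h, one_zpow]

theorem tvnz_zpow_le (q : ℂ) (w : ℤ) : ‖tvnz q ^ w‖ ≤ 1 := by
  by_cases h : q = 0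
  · subst h
    rw [norm_zpow, tvnz, norm_div, norm_zero, zero_div]
    by_cases hw : w = 0
    · simp [hw]
    · rw [zero_zpow _ hw]; exact zero_le_one
  · exact (tvnz_zpow_norm h w).le

theorem tvnz_ofReal {t : ℝ} (h : 0 < t) : tvnz (t : ℂ) = 1 := by
  unfold tvnz
  rw [Complex.norm_real, Real.norm_of_nonneg h.le, div_self]
  exact_mod_cast h.ne'

theorem tvnz_contAt {Y : Type*} [TopologicalSpace Y] {g : Y → ℂ} {y : Y} (hg : ContinuousAt g y)
    (h : g y ≠ 0) (w : ℤ) : ContinuousAt (fun y => tvnz (g y) ^ w) y := by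
  have h1 : (‖g y‖ : ℂ) ≠ 0 := by exact_mod_cast norm_ne_zero_iff.2 h
  refine ContinuousAt.zpow₀ ?_ _ (Or.inl ?_)
  · unfold tvnz
    exact hg.div (by fun_prop) h1
  · rw [← norm_ne_zero_iff, tvnz_norm h]; exact one_ne_zero

theorem tv_mul_cont {Y : Type*} [TopologicalSpace Y] {g U : Y → ℂ} (hg : Continuous g)
    (hU : ∀ y, g y ≠ 0 → ContinuousAt U y) (hb : ∀ y, ‖U y‖ ≤ 1) :
    Continuous fun y => g y * U y := by
  rw [continuous_iff_continuousAt]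
  intro y
  by_cases h : g y = 0
  · rw [ContinuousAt, h, zero_mul]
    refine squeeze_zero_norm (a := fun y => ‖g y‖) (fun y => ?_) ?_
    · rw [norm_mul]
      exact mul_le_of_le_one_right (norm_nonneg _) (hb y)
    · have := (hg.norm.continuousAt (x := y)).tendsto
      rwa [h, norm_zero] at this
  · exact hg.continuousAt.mul (hU y h)

theorem tvp_ne {η : ℝ} (hη : 0 < η) {z : ℂ} (hz : z ≠ 0) : tvp η z ≠ 0 := by
  intro h
  apply hz
  refine tvp_key hη (s := 0) ⟨le_rfl, zero_le_one⟩ ?_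
  rw [h]; simp

noncomputable def tvD (η : ℝ) (w : ℤ) (z : ℂ) : ℂ := z * tvnz (tvp η z) ^ w - z

theorem tvD_cont {η : ℝ} (hη : 0 < η) (w : ℤ) : Continuous (tvD η w) := by
  unfold tvD
  refine Continuous.sub (tv_mul_cont continuous_id (fun y hy => ?_) (fun y => tvnz_zpow_le _ _)) continuous_id
  exact tvnz_contAt (tvp_cont η).continuousAt (tvp_ne hη hy) w

theorem tvnz_of_not {η : ℝ} {z : ℂ} (hz : z ≠ 0) (h : ¬ 0 < tvS η z) : tvnz (tvp η z) = 1 := by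
  rw [tvp_of_not (le_antisymm (not_lt.1 h) (tvS_nonneg _ _)), tvnz_ofReal (norm_pos_iff.2 hz)]

theorem tvD_of_not {η : ℝ} {w : ℤ} {z : ℂ} (h : ¬ 0 < tvS η z) : tvD η w z = 0 := by
  by_cases hz : z = 0
  · simp [tvD, hz]
  · rw [tvD, tvnz_of_not hz h]; simp

theorem tvD_add_norm {η : ℝ} (hη : 0 < η) (w : ℤ) (z : ℂ) : ‖z + tvD η w z‖ = ‖z‖ := by
  have : z + tvD η w z = z * tvnz (tvp η z) ^ w := by simp [tvD]
  rw [this, norm_mul]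
  by_cases hz : z = 0
  · simp [hz]
  · rw [tvnz_zpow_norm (tvp_ne hη hz), mul_one]

theorem tvS_two {η : ℝ} (hη0 : 0 < η) (h1 : η ≤ 1 / 2) {z β : ℂ} (hz : 0 < tvS η z)
    (hz' : 0 < tvS η (β * z)) : |β.im| < 4 * η * β.re := by
  rw [tvS_pos] at hz hz'
  set z' := β * z with hz'd
  have hx : 0 < z.re * η := by have := abs_nonneg z.im; linarith
  have hx' : 0 < z'.re * η := by have := abs_nonneg z'.im; linarith
  have hzr : 0 < z.re := by nlinarith
  have hzr' : 0 < z'.re := by nlinarith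
  have hre : z'.re = β.re * z.re - β.im * z.im := Complex.mul_re _ _
  have him : z'.im = β.re * z.im + β.im * z.re := Complex.mul_im _ _
  have hn : 0 < z.re ^ 2 + z.im ^ 2 := by positivity
  have e1 : β.re * (z.re ^ 2 + z.im ^ 2) = z.re * z'.re + z.im * z'.im := by rw [hre, him]; ring
  have e2 : β.im * (z.re ^ 2 + z.im ^ 2) = z.re * z'.im - z.im * z'.re := by rw [hre, him]; ring
  have b1 : |z.im| * |z'.im| ≤ (η * z.re) * (η * z'.re) :=
    mul_le_mul hz.le hz'.le (abs_nonneg _) (by positivity)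
  have b2 : |z.re * z'.im - z.im * z'.re| < 2 * η * (z.re * z'.re) := by
    have := abs_sub (z.re * z'.im) (z.im * z'.re)
    rw [abs_mul, abs_mul, abs_of_pos hzr, abs_of_pos hzr'] at this
    nlinarith
  have b3 : -(|z.im| * |z'.im|) ≤ z.im * z'.im := by
    rw [← abs_mul]; exact neg_abs_le _
  have b4 : (3 / 4) * (z.re * z'.re) ≤ z.re * z'.re + z.im * z'.im := by
    have : (η * z.re) * (η * z'.re) ≤ 1 / 4 * (z.re * z'.re) := by
      have h3 : η * η ≤ 1 / 4 := by nlinarith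
      have := mul_le_mul_of_nonneg_right h3 (mul_pos hzr hzr').le
      linarith
    linarith
  have b5 : |β.im| * (z.re ^ 2 + z.im ^ 2) < 4 * η * β.re * (z.re ^ 2 + z.im ^ 2) := by
    have : |β.im| * (z.re ^ 2 + z.im ^ 2) = |β.im * (z.re ^ 2 + z.im ^ 2)| := by
      rw [abs_mul, abs_of_pos hn]
    rw [this, e2, mul_assoc (4 * η), e1]
    have h7 := mul_le_mul_of_nonneg_left b4 (by positivity : 0 ≤ 4 * η)
    have h8 : 0 < η * (z.re * z'.re) := by positivity
    nlinarith
  exact lt_of_mul_lt_mul_right b5 hn.le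

end TvPartK

section TvPartL
open Set Filter Topology

/-! Part 3b: the equivariant map -/

noncomputable def tvZ {r : ℕ} (J : Finset (Fin r)) (x : Fin r → TvE) : ℂ :=
  (∑ i ∈ J, (x i).1) / (J.card : ℂ) - (∑ i ∈ Jᶜ, (x i).1) / (Jᶜ.card : ℂ)

noncomputable def tvI {r : ℕ} (J : Finset (Fin r)) (z : ℂ) : Fin r → TvE :=
  fun i => if i ∈ J then (z, 0) else 0

noncomputable def tvcl (t : ℝ) : ℝ := max 0 (min 1 t)

noncomputable def tvU {r : ℕ} (J : Finset (Fin r)) (x : Fin r → TvE) : Fin r → TvE :=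
  x - tvI J (tvZ J x)

noncomputable def tvLam {r : ℕ} (ε c : ℝ) (J : Finset (Fin r)) (x : Fin r → TvE) : ℝ :=
  tvcl (1 - tvN (tvU J x) / ε) * tvcl ((tvZ J x).re / c - 1)

theorem tvcl_cont : Continuous tvcl := by unfold tvcl; fun_prop

theorem tvcl_nonneg (t : ℝ) : 0 ≤ tvcl t := le_max_left _ _

theorem tvcl_pos {t : ℝ} (h : 0 < tvcl t) : 0 < t := by
  unfold tvcl at h
  rcases lt_max_iff.1 h with h | h
  · exact absurd h (lt_irrefl _)
  · exact (lt_min_iff.1 h).2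

theorem tvcl_one {t : ℝ} (h : 1 ≤ t) : tvcl t = 1 := by
  unfold tvcl; rw [min_eq_left h]; norm_num

theorem tvZ_cont {r : ℕ} (J : Finset (Fin r)) : Continuous (tvZ J) := by
  unfold tvZ
  fun_prop

theorem tvI_cont {r : ℕ} (J : Finset (Fin r)) : Continuous (tvI J) := by
  unfold tvI
  refine continuous_pi fun i => ?_
  split_ifs <;> fun_prop

theorem tvU_cont {r : ℕ} (J : Finset (Fin r)) : Continuous (tvU J) := by
  unfold tvU
  have := tvI_cont J
  have := tvZ_cont J
  fun_prop

theorem tvLam_cont {r : ℕ} (ε c : ℝ) (J : Finset (Fin r)) : Continuous (tvLam ε c J) := by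
  unfold tvLam
  have h1 : Continuous fun x : Fin r → TvE => tvN (tvU J x) := tvN_continuous.comp (tvU_cont J)
  have := tvZ_cont J
  exact (tvcl_cont.comp (by fun_prop)).mul (tvcl_cont.comp (by fun_prop))

theorem tvLam_pos {r : ℕ} {ε c : ℝ} (hε : 0 < ε) (hc : 0 < c) {J : Finset (Fin r)}
    {x : Fin r → TvE} (h : tvLam ε c J x ≠ 0) : tvN (tvU J x) < ε ∧ c < (tvZ J x).re := by
  unfold tvLam at h
  have h1 := (tvcl_nonneg (1 - tvN (tvU J x) / ε)).lt_of_ne' (left_ne_zero_of_mul h)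
  have h2 := (tvcl_nonneg ((tvZ J x).re / c - 1)).lt_of_ne' (right_ne_zero_of_mul h)
  have h3 := tvcl_pos h1
  have h4 := tvcl_pos h2
  rw [sub_pos] at h3 h4
  exact ⟨(div_lt_one hε).1 h3, (one_lt_div hc).1 h4⟩

theorem tvLam_one {r : ℕ} {ε c : ℝ} (hc : 0 < c) {J : Finset (Fin r)}
    {x : Fin r → TvE} (h : tvN (tvU J x) = 0) (h2 : 2 * c ≤ (tvZ J x).re) : tvLam ε c J x = 1 := by
  unfold tvLam
  rw [h, tvcl_one (by simp), tvcl_one, one_mul]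
  rw [le_sub_iff_add_le, le_div_iff₀ hc]; linarith

theorem tvN_le {r : ℕ} (x : Fin r → TvE) (i j : Fin r) : ‖x i - x j‖ ≤ tvN x :=
  norm_le_pi_norm (fun p : Fin r × Fin r => x p.1 - x p.2) (i, j)

theorem tvLam_unique {r : ℕ} {ε c : ℝ} (hε : 0 < ε) (hc : 0 < c) (hεc : 2 * ε ≤ c)
    {J J' : Finset (Fin r)} (hJ : J ∈ tvJ r) {x : Fin r → TvE}
    (h : tvLam ε c J x ≠ 0) (h' : tvLam ε c J' x ≠ 0) : J = J' := by
  obtain ⟨h1, h2⟩ := tvLam_pos hε hc h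
  obtain ⟨h1', h2'⟩ := tvLam_pos hε hc h'
  by_contra hne
  obtain ⟨hJ1, hJ2⟩ := mem_tvJ.1 hJ
  have : ∃ i ∈ J, ∃ j, j ∉ J ∧ (i ∉ J' ∨ j ∈ J') := by
    by_contra hcon
    push Not at hcon
    apply hne
    obtain ⟨i, hi⟩ := hJ1
    obtain ⟨j, hj⟩ : ∃ k, k ∉ J := by
      by_contra h; push Not at h
      exact hJ2 (Finset.eq_univ_iff_forall.2 h)
    ext k
    by_cases hk : k ∈ J
    · simp [hk, (hcon k hk j hj).1]
    · simp [hk, (hcon i hi k hk).2]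
  obtain ⟨i, hi, j, hj, hij⟩ := this
  have k1 := (Complex.abs_re_le_norm _).trans ((norm_fst_le (tvU J x i - tvU J x j)).trans (tvN_le (tvU J x) i j))
  have k2 := (Complex.abs_re_le_norm _).trans ((norm_fst_le (tvU J' x i - tvU J' x j)).trans (tvN_le (tvU J' x) i j))
  have l1 := (abs_lt.1 (lt_of_le_of_lt k1 h1)).1
  have l2 := (abs_lt.1 (lt_of_le_of_lt k2 h1')).2
  simp only [tvU, tvI, Pi.sub_apply, hi, hj, if_true, if_false, Prod.fst_sub, Complex.sub_re] at l1 l2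
  by_cases hi' : i ∈ J' <;> by_cases hj' : j ∈ J' <;> simp [hi', hj'] at l1 l2 hij <;> linarith

theorem tvZ_line {r : ℕ} {J : Finset (Fin r)} (hJ : J ∈ tvJ r) {x : Fin r → TvE} {z : ℂ}
    {κ : TvE} (h : ∀ i, x i = κ + tvI J z i) : tvZ J x = z := by
  obtain ⟨hJ1, hJ2⟩ := mem_tvJ.1 hJ
  have c1 : (J.card : ℂ) ≠ 0 := by
    exact_mod_cast hJ1.card_pos.ne'
  have c2 : (Jᶜ.card : ℂ) ≠ 0 := by
    have : Jᶜ.Nonempty := by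
      rw [Finset.nonempty_iff_ne_empty, ne_eq, Finset.compl_eq_empty_iff]; exact hJ2
    exact_mod_cast this.card_pos.ne'
  have e1 : ∑ i ∈ J, (x i).1 = J.card * (κ.1 + z) := by
    rw [Finset.sum_congr rfl (g := fun _ => κ.1 + z)]
    · rw [Finset.sum_const, nsmul_eq_mul]
    · intro i hi; simp [h, tvI, hi]
  have e2 : ∑ i ∈ Jᶜ, (x i).1 = Jᶜ.card * κ.1 := by
    rw [Finset.sum_congr rfl (g := fun _ => κ.1)]
    · simp
    · intro i hi; simp [h, tvI, Finset.mem_compl.1 hi]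
  rw [tvZ, e1, e2, mul_div_cancel_left₀ _ c1, mul_div_cancel_left₀ _ c2]
  ring

theorem tvU_line {r : ℕ} {J : Finset (Fin r)} (hJ : J ∈ tvJ r) {x : Fin r → TvE} {z : ℂ}
    {κ : TvE} (h : ∀ i, x i = κ + tvI J z i) : tvN (tvU J x) = 0 := by
  rw [tvN, norm_eq_zero]
  funext p
  simp [tvU, tvZ_line hJ h, h]

theorem tvN_line {r : ℕ} {J : Finset (Fin r)} {x : Fin r → TvE} {z : ℂ}
    {κ : TvE} (h : ∀ i, x i = κ + tvI J z i) : tvN x ≤ ‖z‖ := by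
  rw [tvN, pi_norm_le_iff_of_nonneg (norm_nonneg _)]
  intro p
  rw [h, h, add_sub_add_left_eq_sub]
  unfold tvI
  split_ifs <;> simp [Prod.norm_def]

theorem tvN_perm_le {r : ℕ} (x : Fin r → TvE) (σ : Equiv.Perm (Fin r)) : tvN (x ∘ σ) ≤ tvN x := by
  rw [tvN, pi_norm_le_iff_of_nonneg (tvN_nonneg _)]
  intro p
  exact tvN_le x _ _

theorem tvN_perm {r : ℕ} (x : Fin r → TvE) (σ : Equiv.Perm (Fin r)) : tvN (x ∘ σ) = tvN x := by
  refine le_antisymm (tvN_perm_le _ _) ?_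
  have := tvN_perm_le (x ∘ σ) σ⁻¹
  have e : (x ∘ σ) ∘ ⇑σ⁻¹ = x := by funext i; simp
  rwa [e] at this

theorem tvZ_perm {r : ℕ} (J : Finset (Fin r)) (x : Fin r → TvE) (σ : Equiv.Perm (Fin r)) :
    tvZ J (x ∘ σ) = tvZ (J.map σ.toEmbedding) x := by
  have : (J.map σ.toEmbedding)ᶜ = Jᶜ.map σ.toEmbedding := by
    ext i; simp [Finset.mem_map_equiv]
  rw [tvZ, tvZ, this, Finset.sum_map, Finset.sum_map, Finset.card_map, Finset.card_map]
  rfl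

theorem tvI_perm {r : ℕ} (J : Finset (Fin r)) (z : ℂ) (σ : Equiv.Perm (Fin r)) :
    tvI (J.map σ.toEmbedding) z ∘ σ = tvI J z := by
  funext i
  simp [tvI]

theorem tvU_perm {r : ℕ} (J : Finset (Fin r)) (x : Fin r → TvE) (σ : Equiv.Perm (Fin r)) :
    tvU J (x ∘ σ) = tvU (J.map σ.toEmbedding) x ∘ σ := by
  rw [tvU, tvU, tvZ_perm, ← tvI_perm J _ σ]
  rfl

theorem tvLam_perm {r : ℕ} (ε c : ℝ) (J : Finset (Fin r)) (x : Fin r → TvE) (σ : Equiv.Perm (Fin r)) :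
    tvLam ε c J (x ∘ σ) = tvLam ε c (J.map σ.toEmbedding) x := by
  rw [tvLam, tvLam, tvU_perm, tvN_perm, tvZ_perm]

noncomputable def tvPhi {r : ℕ} (ε c η : ℝ) (w : ℕ → ℤ) (x : Fin r → TvE) : Fin r → TvE :=
  x + ∑ J ∈ tvJ r, tvI J (tvLam ε c J x * tvD η (w J.card) (tvZ J x))

theorem tvPhi_cont {r : ℕ} (ε c : ℝ) {η : ℝ} (hη : 0 < η) (w : ℕ → ℤ) :
    Continuous (tvPhi ε c η w : (Fin r → TvE) → _) := by
  unfold tvPhi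
  refine continuous_id.add (continuous_finsetSum _ fun J _ => (tvI_cont J).comp ?_)
  refine Continuous.mul (Complex.continuous_ofReal.comp (tvLam_cont ε c J)) ((tvD_cont hη _).comp (tvZ_cont J))

theorem tvPhi_perm {r : ℕ} (ε c η : ℝ) (w : ℕ → ℤ) (x : Fin r → TvE) (σ : Equiv.Perm (Fin r)) :
    tvPhi ε c η w (x ∘ σ) = tvPhi ε c η w x ∘ σ := by
  have e : ∑ J ∈ tvJ r, tvI J (tvLam ε c J x * tvD η (w J.card) (tvZ J x)) =
    ∑ J ∈ tvJ r, tvI (J.map σ.toEmbedding) (tvLam ε c (J.map σ.toEmbedding) x *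
      tvD η (w (J.map σ.toEmbedding).card) (tvZ (J.map σ.toEmbedding) x)) := by
    symm
    refine Finset.sum_equiv (Equiv.finsetCongr σ) ?_ ?_
    · intro J
      rw [mem_tvJ, mem_tvJ, Equiv.finsetCongr_apply, Finset.map_nonempty]
      have : J.map σ.toEmbedding = Finset.univ ↔ J = Finset.univ := by
        constructor
        · intro h
          apply Finset.map_injective σ.toEmbedding
          rw [h, Finset.map_univ_equiv]
        · rintro rfl
          exact Finset.map_univ_equiv σ
      rw [ne_eq, ne_eq, this]
    · intro J _
      rfl
  funext i
  rw [Function.comp_apply, tvPhi, tvPhi, e]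
  simp only [Pi.add_apply, Function.comp_apply, Finset.sum_apply, tvLam_perm, tvZ_perm, Finset.card_map]
  congr 1
  refine Finset.sum_congr rfl fun J _ => ?_
  rw [← tvI_perm J _ σ]
  rfl

theorem tv_id_params {r : ℕ} (K2 : Set (Fin r → TvE)) (hK2 : IsCompact K2)
    (h : ∀ x ∈ K2, ∀ J ∈ tvJ r, ∀ κ : TvE, ∀ ρ : ℝ, 0 ≤ ρ → ¬ ∀ i, x i = κ + tvI J (ρ : ℂ) i) :
    ∃ δ > 0, ∃ η0 > 0, ∀ ε c η : ℝ, 0 < ε → ε ≤ δ → 0 < c → 0 < η → η ≤ η0 → ∀ w : ℕ → ℤ,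
      ∀ x ∈ K2, tvPhi ε c η w x = x := by
  classical
  have : CompactSpace K2 := isCompact_iff_compactSpace.1 hK2
  let q : Finset (Fin r) → (Fin r → TvE) → ℝ := fun J x =>
    tvN (tvU J x) + |(tvZ J x).im| + max 0 (-(tvZ J x).re)
  have hq : ∀ J : tvJ r, ∃ δ > 0, ∀ x : K2, δ ≤ q J x := by
    rintro ⟨J, hJ⟩
    refine tv_exists_lower _ ?_ ?_
    · have h1 : Continuous fun x : Fin r → TvE => tvN (tvU J x) := tvN_continuous.comp (tvU_cont J)
      have h2 := tvZ_cont J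
      have : Continuous (q J) := by
        simp only [q]; fun_prop
      exact this.comp continuous_subtype_val
    · rintro ⟨x, hx⟩
      by_contra hneg
      have n1 := tvN_nonneg (tvU J x)
      have n2 := abs_nonneg (tvZ J x).im
      have n3 := le_max_left 0 (-(tvZ J x).re)
      simp only [q] at hneg
      have m1 : tvN (tvU J x) = 0 := by linarith
      have m2 : (tvZ J x).im = 0 := by rw [← abs_eq_zero]; linarith
      have m3 : 0 ≤ (tvZ J x).re := by
        have := le_max_right 0 (-(tvZ J x).re); linarith
      obtain ⟨i0, -⟩ := (mem_tvJ.1 hJ).1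
      apply h x hx J hJ (tvU J x i0) _ m3
      intro i
      have e1 : ((tvZ J x).re : ℂ) = tvZ J x := Complex.ext (by simp) (by simp [m2])
      rw [e1]
      have : tvU J x i = tvU J x i0 := by
        have := tvN_le (tvU J x) i i0
        rw [m1] at this
        exact sub_eq_zero.1 (norm_le_zero_iff.1 this)
      rw [← this]; simp [tvU]
  choose d hd hdq using hq
  obtain ⟨δ, hδ, hδd⟩ := tv_finite_lower d hd
  have hR : ∃ R : ℝ, ∀ x ∈ K2, ∀ J, ‖tvZ J x‖ ≤ R := by
    obtain ⟨R, hR⟩ := hK2.exists_bound_of_continuousOn (f := fun x (J : Finset (Fin r)) => tvZ J x)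
      (continuous_pi fun J => tvZ_cont J).continuousOn
    exact ⟨R, fun x hx J => (norm_le_pi_norm (fun J => tvZ J x) J).trans (hR x hx)⟩
  obtain ⟨R, hR⟩ := hR
  refine ⟨δ / 2, by positivity, δ / (2 * (|R| + 1)), by positivity, ?_⟩
  intro ε c η hε hεδ hc hη hηη w x hx
  rw [tvPhi, add_eq_left]
  refine Finset.sum_eq_zero fun J hJ => ?_
  have : (tvLam ε c J x : ℂ) * tvD η (w J.card) (tvZ J x) = 0 := by
    by_contra hne
    have hl : tvLam ε c J x ≠ 0 := by exact_mod_cast left_ne_zero_of_mul hne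
    obtain ⟨h1, h2⟩ := tvLam_pos hε hc hl
    have hs : 0 < tvS η (tvZ J x) := by
      by_contra hs
      exact right_ne_zero_of_mul hne (tvD_of_not hs)
    rw [tvS_pos] at hs
    have h3 := (hδd ⟨J, hJ⟩).trans (hdq ⟨J, hJ⟩ ⟨x, hx⟩)
    simp only [q] at h3
    rw [max_eq_left (by linarith : -(tvZ J x).re ≤ 0)] at h3
    have h4 : (tvZ J x).re ≤ |R| + 1 := by
      have := Complex.re_le_norm (tvZ J x)
      have := hR x hx J
      have := le_abs_self R
      linarith
    have h5 : η * (tvZ J x).re ≤ δ / 2 := by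
      rw [le_div_iff₀ (by positivity)] at hηη
      nlinarith
    linarith
  rw [this]
  funext i; simp [tvI]

end TvPartL

section TvPartM
open Set Filter Topology

/-! Part 3c: the homotopies -/

theorem tv_line_contra {r : ℕ} {η c : ℝ} (hη : 0 < η) (hη2 : η ≤ 1 / 2) (hc : 0 < c)
    {x : Fin r → TvE} (hx : 4 * c ≤ tvN x) {J : Finset (Fin r)} (hJ : J ∈ tvJ r) (μ : ℝ) (ζ : ℂ)
    (w : ℤ) (hζ : ∀ κ z, (∀ i, x i = κ + tvI J z i) → ζ = z)
    (hμ : tvN (tvU J x) = 0 → 2 * c ≤ (tvZ J x).re → μ = 1)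
    (κ : TvE) (h : ∀ i, x i + tvI J (μ * tvD η w ζ) i = κ) : False := by
  have hl : ∀ i, x i = κ + tvI J (-(μ * tvD η w ζ)) i := by
    intro i
    rw [← h i]
    unfold tvI
    split_ifs <;> ext <;> simp
  set z := -(μ * tvD η w ζ) with hz
  have h1 := hζ _ _ hl
  have h2 := tvN_line hl
  by_cases hs : 0 < tvS η ζ
  · rw [h1, tvS_pos] at hs
    have h3 := Complex.norm_le_abs_re_add_abs_im z
    have hre : 0 ≤ z.re := by
      have := abs_nonneg z.im
      by_contra hneg
      push Not at hneg
      nlinarith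
    rw [abs_of_nonneg hre] at h3
    have h4 : 2 * c ≤ (tvZ J x).re := by
      rw [tvZ_line hJ hl]
      nlinarith
    have h5 := hμ (tvU_line hJ hl) h4
    rw [h5, h1] at hz
    have h6 := tvD_add_norm hη w z
    have h7 : z + tvD η w z = 0 := by
      nth_rewrite 1 [hz]; simp
    rw [h7, norm_zero] at h6
    linarith
  · rw [tvD_of_not hs, mul_zero, neg_zero] at hz
    rw [hz, norm_zero] at h2
    linarith

theorem tv_sum_single {r : ℕ} (hr : 2 ≤ r) (m : Finset (Fin r) → ℂ)
    (h : ∀ J ∈ tvJ r, ∀ J' ∈ tvJ r, m J ≠ 0 → m J' ≠ 0 → J = J') :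
    ∃ J ∈ tvJ r, ∀ J' ∈ tvJ r, J' ≠ J → m J' = 0 := by
  by_cases h0 : ∃ J ∈ tvJ r, m J ≠ 0
  · obtain ⟨J, hJ, hm⟩ := h0
    refine ⟨J, hJ, fun J' hJ' hne => ?_⟩
    by_contra hm'
    exact hne (h J' hJ' J hJ hm' hm)
  · push Not at h0
    refine ⟨{⟨0, by omega⟩}, ?_, fun J' hJ' _ => h0 J' hJ'⟩
    rw [mem_tvJ]
    refine ⟨by simp, fun he => ?_⟩
    have : (⟨1, by omega⟩ : Fin r) ∈ ({⟨0, by omega⟩} : Finset (Fin r)) := he ▸ Finset.mem_univ _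
    simp at this

noncomputable def tvF {r : ℕ} (a : Fin r → ℂ) (x : Fin r → TvE) : ℂ := ∑ k, a k * (x k).1

theorem tvF_cont {r : ℕ} (a : Fin r → ℂ) : Continuous (tvF a) := by
  unfold tvF; fun_prop

theorem tvF_add {r : ℕ} (a : Fin r → ℂ) (x y : Fin r → TvE) : tvF a (x + y) = tvF a x + tvF a y := by
  simp [tvF, mul_add, Finset.sum_add_distrib]

theorem tvF_sub {r : ℕ} (a : Fin r → ℂ) (x y : Fin r → TvE) : tvF a (x - y) = tvF a x - tvF a y := by
  simp [tvF, mul_sub, Finset.sum_sub_distrib]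

theorem tvF_smul {r : ℕ} (a : Fin r → ℂ) (s : ℝ) (x : Fin r → TvE) : tvF a (s • x) = s * tvF a x := by
  simp only [tvF, Pi.smul_apply, Prod.smul_fst, Complex.real_smul, Finset.mul_sum]
  refine Finset.sum_congr rfl fun k _ => by ring

theorem tvF_I {r : ℕ} (a : Fin r → ℂ) (J : Finset (Fin r)) (z : ℂ) :
    tvF a (tvI J z) = (∑ k ∈ J, a k) * z := by
  have : ∀ k, a k * (tvI J z k).1 = if k ∈ J then a k * z else 0 := by
    intro k; unfold tvI; split_ifs <;> simp
  simp only [tvF, this, Finset.sum_ite_mem, Finset.univ_inter, Finset.sum_mul]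

theorem tvF_const {r : ℕ} (a : Fin r → ℂ) (ha : ∑ k, a k = 0) (x : Fin r → TvE) (κ : TvE)
    (h : ∀ i, x i = κ) : tvF a x = 0 := by
  simp only [tvF, h, ← Finset.sum_mul, ha, zero_mul]

theorem tvF_line {r : ℕ} (a : Fin r → ℂ) (ha : ∑ k, a k = 0) (x : Fin r → TvE) (κ : TvE)
    (J : Finset (Fin r)) (z : ℂ)
    (h : ∀ i, x i = κ + tvI J z i) : tvF a x = (∑ k ∈ J, a k) * z := by
  have : x = (fun _ => κ) + tvI J z := funext h
  rw [this, tvF_add, tvF_const a ha _ κ fun _ => rfl, zero_add, tvF_I]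

theorem tvNC_or {r : ℕ} (hr : 2 ≤ r) (x : Fin r → TvE) : TvNC x ∨ ∃ κ, ∀ i, x i = κ := by
  by_cases h : TvNC x
  · exact Or.inl h
  · right
    unfold TvNC at h
    push Not at h
    exact ⟨x ⟨0, by omega⟩, fun i => h _ _⟩

theorem tvNC_of_F {r : ℕ} (hr : 2 ≤ r) (a : Fin r → ℂ) (ha : ∑ k, a k = 0) (x y : Fin r → TvE)
    (hx : TvNC x) (h : tvF a y = 0 → y = x) : TvNC y := by
  rcases tvNC_or hr y with h1 | ⟨κ, hκ⟩
  · exact h1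
  · rw [h (tvF_const a ha y κ hκ)]; exact hx

theorem tv_prod_zpow {ι : Type*} (s : Finset ι) (g : ℂ) (hg : g ≠ 0) (w : ι → ℤ) :
    ∏ j ∈ s, g ^ w j = g ^ ∑ j ∈ s, w j := by
  classical
  induction s using Finset.induction_on with
  | empty => simp
  | insert j s hj ih => rw [Finset.prod_insert hj, Finset.sum_insert hj, zpow_add₀ hg, ih]

theorem tv_eta_f {r : ℕ} (a : Fin r → ℂ) (ha0 : ∀ J ∈ tvJ r, ∑ k ∈ J, a k ≠ 0)
    (ha1 : ∀ J ∈ tvJ r, ∀ J' ∈ tvJ r, J ≠ J' → ∀ β : ℝ, 0 < β →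
        ∑ k ∈ J, a k ≠ β * ∑ k ∈ J', a k) :
    ∃ η0 > 0, ∀ η : ℝ, 0 < η → η ≤ η0 → η ≤ 1 / 2 → ∀ z : ℂ, ∀ J ∈ tvJ r, ∀ J' ∈ tvJ r,
      0 < tvS η (z / ∑ k ∈ J, a k) → 0 < tvS η (z / ∑ k ∈ J', a k) → J = J' := by
  classical
  let β : Finset (Fin r) × Finset (Fin r) → ℂ := fun p => (∑ k ∈ p.1, a k) / ∑ k ∈ p.2, a k
  let d : {p : Finset (Fin r) × Finset (Fin r) // p.1 ∈ tvJ r ∧ p.2 ∈ tvJ r ∧ p.1 ≠ p.2} → ℝ :=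
    fun p => if 0 < (β p.1).re then |(β p.1).im| / (4 * (β p.1).re) else 1
  have hd : ∀ p, 0 < d p := by
    rintro ⟨⟨J, J'⟩, hJ, hJ', hne⟩
    simp only [d]
    split_ifs with h
    · have : (β (J, J')).im ≠ 0 := by
        intro him
        apply ha1 J hJ J' hJ' hne _ h
        have e : ((β (J, J')).re : ℂ) = β (J, J') := Complex.ext (by simp) (by simp [him])
        rw [e]
        simp only [β]
        rw [div_mul_cancel₀ _ (ha0 J' hJ')]
      have := abs_pos.2 this
      positivity
    · exact one_pos
  obtain ⟨η0, h0, h1⟩ := tv_finite_lower d hd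
  refine ⟨η0, h0, ?_⟩
  intro η hη hη0 hη2 z J hJ J' hJ' hs hs'
  by_contra hne
  have e : z / ∑ k ∈ J', a k = β (J, J') * (z / ∑ k ∈ J, a k) := by
    simp only [β]
    have := ha0 J hJ
    have := ha0 J' hJ'
    field_simp
  rw [e] at hs'
  have h2 := tvS_two hη hη2 hs hs'
  have h3 := h1 ⟨(J, J'), hJ, hJ', hne⟩
  simp only [d] at h3
  have h4 : 0 < (β (J, J')).re := by
    have := abs_nonneg (β (J, J')).im
    by_contra hneg
    push Not at hneg
    nlinarith
  rw [if_pos h4, le_div_iff₀ (by positivity)] at h3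
  nlinarith

theorem tv_null {r : ℕ} (hr : 2 ≤ r) (w : ℕ → ℤ) (hw : ∑ J ∈ tvJ r, w J.card = -1)
    (a : Fin r → ℂ) (ha : ∑ k, a k = 0) (ha0 : ∀ J ∈ tvJ r, ∑ k ∈ J, a k ≠ 0)
    (K : Set (Fin r → TvE)) (ε c η : ℝ) (hε : 0 < ε) (hc : 0 < c) (hεc : 2 * ε ≤ c)
    (hη : 0 < η) (hη2 : η ≤ 1 / 2) (hK : ∀ x ∈ K, 4 * c ≤ tvN x)
    (hu : ∀ z : ℂ, ∀ J ∈ tvJ r, ∀ J' ∈ tvJ r,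
      0 < tvS η (z / ∑ k ∈ J, a k) → 0 < tvS η (z / ∑ k ∈ J', a k) → J = J')
    (b : K → Fin r → TvE) (f0 : C(K, Fin r → TvE)) (hf0 : ∀ x : K, f0 x = tvPhi ε c η w x) :
    ∃ c' : Fin r → TvE, TvNC c' ∧
      ContinuousMap.HomotopicWith f0 (ContinuousMap.const _ c') (TvP ∅ b) := by
  classical
  obtain ⟨J0, hJ0, -⟩ := tv_sum_single hr (fun _ => 0) (by simp)
  let aJ : Finset (Fin r) → ℂ := fun J => ∑ k ∈ J, a k
  have haJ : ∀ J ∈ tvJ r, aJ J ≠ 0 := ha0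
  have hKN : ∀ x : K, TvNC x.1 := fun x => tvN_pos.1 (by have := hK x.1 x.2; linarith)
  let D : Finset (Fin r) → ℂ → ℂ := fun J => tvD η (w J.card)
  let g : ℂ → Fin r → TvE := fun z => tvI J0 (z / aJ J0)
  have hg : Continuous g := (tvI_cont J0).comp (by fun_prop)
  have hgF : ∀ z, tvF a (g z) = z := fun z => by
    simp only [g]; rw [tvF_I, mul_div_cancel₀ _ (haJ J0 hJ0)]
  have hg0 : g 0 = 0 := by funext i; simp [g, tvI]
  have hgadd : ∀ z z', g (z + z') = g z + g z' := by
    intro z z'; funext i; simp only [g, tvI, Pi.add_apply, add_div]; split_ifs <;> simp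
  have hDc : ∀ J, Continuous (D J) := fun J => tvD_cont hη _
  have hvalc : Continuous fun p : ℝ × K => (p.2 : Fin r → TvE) := continuous_subtype_val.comp continuous_snd
  have hFc : Continuous fun p : ℝ × K => tvF a p.2 := (tvF_cont a).comp hvalc
  -- uniqueness for the last phases
  have hDu : ∀ z, ∃ J ∈ tvJ r, ∀ J' ∈ tvJ r, J' ≠ J → D J' (z / aJ J') = 0 := by
    intro z
    refine tv_sum_single hr (fun J => D J (z / aJ J)) ?_
    intro J hJ J' hJ' h h'
    refine hu z J hJ J' hJ' ?_ ?_
    · by_contra hn; exact h (tvD_of_not hn)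
    · by_contra hn; exact h' (tvD_of_not hn)
  have hI0 : ∀ J : Finset (Fin r), tvI J (0 : ℂ) = 0 := fun J => by funext i; simp [tvI]
  -- the homotopies
  let H1 : ℝ × K → Fin r → TvE := fun p => p.2 + ∑ J ∈ tvJ r,
    tvI J (tvLam ε c J p.2 * D J ((1 - p.1 : ℝ) * tvZ J p.2 + (p.1 : ℝ) * (tvF a p.2 / aJ J)))
  have hH1 : Continuous H1 := by
    refine hvalc.add (continuous_finsetSum _ fun J _ => (tvI_cont J).comp ?_)
    refine ((Complex.continuous_ofReal.comp (tvLam_cont ε c J)).comp hvalc).mul ((hDc J).comp ?_)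
    have := (tvZ_cont J).comp hvalc
    simp only [Function.comp_def] at this
    fun_prop
  have hn1 : ∀ s ∈ Icc (0 : ℝ) 1, ∀ x, TvNC (H1 (s, x)) := by
    intro s hs x
    rcases tvNC_or hr (H1 (s, x)) with h | ⟨κ, hκ⟩
    · exact h
    exfalso
    obtain ⟨J, hJ, hJu⟩ := tv_sum_single hr (fun J => (tvLam ε c J x : ℂ) *
      D J ((1 - s : ℝ) * tvZ J x + (s : ℝ) * (tvF a x / aJ J))) (by
        intro J hJ J' hJ' h h'
        exact tvLam_unique hε hc hεc hJ (x := x) (by exact_mod_cast left_ne_zero_of_mul h)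
          (by exact_mod_cast left_ne_zero_of_mul h'))
    have e : H1 (s, x) = x + tvI J ((tvLam ε c J x : ℂ) *
      D J ((1 - s : ℝ) * tvZ J x + (s : ℝ) * (tvF a x / aJ J))) := by
      simp only [H1]
      rw [Finset.sum_eq_single_of_mem J hJ]
      intro J' hJ' hne
      rw [hJu J' hJ' hne, hI0]
    refine tv_line_contra hη hη2 hc (hK x x.2) hJ (tvLam ε c J x) _ (w J.card) ?_ ?_ κ
      (fun i => by rw [← hκ i, e]; rfl)
    · intro κ z hl
      rw [tvZ_line hJ hl, tvF_line a ha x κ J z hl]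
      have : (∑ k ∈ J, a k) * z / aJ J = z := mul_div_cancel_left₀ _ (haJ J hJ)
      rw [this]; push_cast; ring
    · intro h h'
      exact tvLam_one hc h h'
  let H2 : ℝ × K → Fin r → TvE := fun p => p.2 + ∑ J ∈ tvJ r,
    tvI J (((1 - p.1) * tvLam ε c J p.2 + p.1 : ℝ) * D J (tvF a p.2 / aJ J))
  have hH2 : Continuous H2 := by
    refine hvalc.add (continuous_finsetSum _ fun J _ => (tvI_cont J).comp ?_)
    have := (tvLam_cont ε c J).comp hvalc
    simp only [Function.comp_def] at this
    refine Continuous.mul (by fun_prop) ((hDc J).comp (by fun_prop))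
  have hn2 : ∀ s ∈ Icc (0 : ℝ) 1, ∀ x, TvNC (H2 (s, x)) := by
    intro s hs x
    rcases tvNC_or hr (H2 (s, x)) with h | ⟨κ, hκ⟩
    · exact h
    exfalso
    obtain ⟨J, hJ, hJu⟩ := hDu (tvF a x)
    have e : H2 (s, x) = x + tvI J (((1 - s) * tvLam ε c J x + s : ℝ) * D J (tvF a x / aJ J)) := by
      simp only [H2]
      rw [Finset.sum_eq_single_of_mem J hJ]
      intro J' hJ' hne
      rw [hJu J' hJ' hne, mul_zero, hI0]
    refine tv_line_contra hη hη2 hc (hK x x.2) hJ ((1 - s) * tvLam ε c J x + s) _ (w J.card) ?_ ?_ κ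
      (fun i => by rw [← hκ i, e]; rfl)
    · intro κ z hl
      rw [tvF_line a ha x κ J z hl]
      exact mul_div_cancel_left₀ _ (haJ J hJ)
    · intro h h'
      rw [tvLam_one hc h h']; ring
  let H3 : ℝ × K → Fin r → TvE := fun p => p.2 + ((1 - p.1) • ∑ J ∈ tvJ r, tvI J (D J (tvF a p.2 / aJ J))
    + p.1 • g (∑ J ∈ tvJ r, aJ J * D J (tvF a p.2 / aJ J)))
  have hH3 : Continuous H3 := by
    have h1 : ∀ J, Continuous fun p : ℝ × K => D J (tvF a p.2 / aJ J) := fun J =>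
      (hDc J).comp (by fun_prop)
    refine hvalc.add (Continuous.add (Continuous.smul (f := fun p : ℝ × K => 1 - p.1) (by fun_prop) ?_) (continuous_fst.smul (hg.comp ?_)))
    · exact continuous_finsetSum _ fun J _ => (tvI_cont J).comp (h1 J)
    · exact continuous_finsetSum _ fun J _ => continuous_const.mul (h1 J)
  have hn3 : ∀ s ∈ Icc (0 : ℝ) 1, ∀ x, TvNC (H3 (s, x)) := by
    intro s hs x
    refine tvNC_of_F hr a ha x _ (hKN x) fun hF => ?_
    obtain ⟨J, hJ, hJu⟩ := hDu (tvF a x)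
    have e1 : ∑ J ∈ tvJ r, tvI J (D J (tvF a x / aJ J)) = tvI J (D J (tvF a x / aJ J)) := by
      rw [Finset.sum_eq_single_of_mem J hJ]
      intro J' hJ' hne
      rw [hJu J' hJ' hne, hI0]
    have e2 : ∑ J ∈ tvJ r, aJ J * D J (tvF a x / aJ J) = aJ J * D J (tvF a x / aJ J) := by
      rw [Finset.sum_eq_single_of_mem J hJ]
      intro J' hJ' hne
      rw [hJu J' hJ' hne, mul_zero]
    simp only [H3] at hF ⊢
    rw [e1, e2] at hF ⊢
    rw [tvF_add, tvF_add, tvF_smul, tvF_smul, hgF, tvF_I] at hF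
    have h1 : aJ J * (tvF a x / aJ J + D J (tvF a x / aJ J)) = 0 := by
      rw [mul_add, mul_div_cancel₀ _ (haJ J hJ), ← hF]
      simp only [aJ]
      push_cast
      ring
    have h2 := (mul_eq_zero.1 h1).resolve_left (haJ J hJ)
    have h3 := tvD_add_norm hη (w J.card) (tvF a x / aJ J)
    simp only [D] at h2
    rw [h2, norm_zero] at h3
    have h4 : tvF a x / aJ J = 0 := norm_eq_zero.1 h3.symm
    have h5 : D J 0 = 0 := by simp [D, tvD]
    rw [h4, h5, mul_zero, hI0, hg0]
    simp
  let U : ℝ × K → ℂ := fun p => ∏ J ∈ tvJ r,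
    tvnz ((1 - tvcl p.1 : ℝ) * tvp η (tvF a p.2 / aJ J) - (tvcl p.1 : ℝ) * (tvF a p.2 / aJ J)) ^ w J.card
  have hcl : ∀ s, tvcl s ∈ Icc (0 : ℝ) 1 := fun s => by
    unfold tvcl; exact ⟨le_max_left _ _, max_le zero_le_one (min_le_left _ _)⟩
  have hUne : ∀ p : ℝ × K, tvF a p.2 ≠ 0 → ∀ J ∈ tvJ r,
      (1 - tvcl p.1 : ℝ) * tvp η (tvF a p.2 / aJ J) - (tvcl p.1 : ℝ) * (tvF a p.2 / aJ J) ≠ 0 := by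
    intro p hp J hJ h
    exact div_ne_zero hp (haJ J hJ) (tvp_key hη (hcl p.1) h)
  have hU1 : ∀ p, tvF a p.2 ≠ 0 → ‖U p‖ = 1 := by
    intro p hp
    simp only [U]
    rw [norm_prod]
    exact Finset.prod_eq_one fun J hJ => tvnz_zpow_norm (hUne p hp J hJ) _
  have hUc : Continuous fun p => tvF a p.2 * U p := by
    refine tv_mul_cont hFc ?_ ?_
    · intro p hp
      simp only [U]
      refine tendsto_finsetProd _ fun J hJ => ?_
      refine tvnz_contAt (g := fun p : ℝ × K => (1 - tvcl p.1 : ℝ) * tvp η (tvF a p.2 / aJ J) -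
        (tvcl p.1 : ℝ) * (tvF a p.2 / aJ J)) ?_ (hUne p hp J hJ) _
      have h1 := tvcl_cont
      have h2 := tvp_cont η
      fun_prop
    · intro p
      simp only [U]
      rw [norm_prod]
      exact Finset.prod_le_one (fun _ _ => norm_nonneg _) fun J hJ => tvnz_zpow_le _ _
  let H4 : ℝ × K → Fin r → TvE := fun p => p.2 + g (tvF a p.2 * U p - tvF a p.2)
  have hH4 : Continuous H4 := hvalc.add (hg.comp (hUc.sub hFc))
  have hn4 : ∀ s ∈ Icc (0 : ℝ) 1, ∀ x, TvNC (H4 (s, x)) := by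
    intro s hs x
    refine tvNC_of_F hr a ha x _ (hKN x) fun hF => ?_
    simp only [H4] at hF ⊢
    rw [tvF_add, hgF, add_sub_cancel] at hF
    have h1 : tvF a x = 0 := by
      by_contra hne
      have := hU1 (s, x) hne
      rw [(mul_eq_zero.1 hF).resolve_left hne, norm_zero] at this
      exact zero_ne_one this
    rw [h1, zero_mul, sub_zero, hg0, add_zero]
  let u0 : ℂ := ∏ J ∈ tvJ r, (-(‖aJ J‖ : ℂ) / aJ J) ^ w J.card
  have hu0 : u0 ≠ 0 := by
    refine Finset.prod_ne_zero_iff.2 fun J hJ => zpow_ne_zero _ (div_ne_zero (neg_ne_zero.2 ?_) (haJ J hJ))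
    exact_mod_cast norm_ne_zero_iff.2 (haJ J hJ)
  have hUend : ∀ x : K, tvF a x * U (1, x) = u0 * ‖tvF a x‖ := by
    intro x
    by_cases hf : tvF a x = 0
    · simp [hf]
    have h1 : tvcl 1 = 1 := tvcl_one le_rfl
    have hfn : (‖tvF a x‖ : ℂ) ≠ 0 := by exact_mod_cast norm_ne_zero_iff.2 hf
    have h2 : U (1, x) = ∏ J ∈ tvJ r, ((-(‖aJ J‖ : ℂ) / aJ J) ^ w J.card *
        (tvF a x / ‖tvF a x‖) ^ w J.card) := by
      refine Finset.prod_congr rfl fun J hJ => ?_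
      rw [← mul_zpow]
      congr 1
      have hJ0 := haJ J hJ
      have hJn : (‖aJ J‖ : ℂ) ≠ 0 := by exact_mod_cast norm_ne_zero_iff.2 hJ0
      simp only [h1, sub_self, Complex.ofReal_zero, zero_mul, zero_sub, Complex.ofReal_one, one_mul, tvnz,
        norm_neg, norm_div, Complex.ofReal_div]
      field_simp
    rw [h2, Finset.prod_mul_distrib, tv_prod_zpow _ _ (div_ne_zero hf hfn), hw, zpow_neg_one]
    simp only [u0]
    field_simp
  let H5 : ℝ × K → Fin r → TvE := fun p => (1 - p.1) • ((p.2 : Fin r → TvE) - g (tvF a p.2)) +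
    g (u0 * ((1 - p.1) * ‖tvF a p.2‖ + p.1 : ℝ))
  have hH5 : Continuous H5 := by
    refine Continuous.add (Continuous.smul (f := fun p : ℝ × K => 1 - p.1) (by fun_prop) (hvalc.sub (hg.comp hFc))) (hg.comp ?_)
    fun_prop
  have hn5 : ∀ s ∈ Icc (0 : ℝ) 1, ∀ x, TvNC (H5 (s, x)) := by
    intro s hs x
    refine tvNC_of_F hr a ha x _ (hKN x) fun hF => ?_
    simp only [H5] at hF ⊢
    rw [tvF_add, tvF_smul, tvF_sub, hgF, hgF, sub_self, mul_zero, zero_add] at hF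
    have h1 := (mul_eq_zero.1 hF).resolve_left hu0
    have h1' : (1 - s) * ‖tvF a x‖ + s = 0 := by exact_mod_cast h1
    have h2 : 0 ≤ (1 - s) * ‖tvF a x‖ := mul_nonneg (sub_nonneg.2 hs.2) (norm_nonneg _)
    have h3 : s = 0 := by have := hs.1; linarith
    subst h3
    have h4 : tvF a x = 0 := by
      rw [← norm_eq_zero]; linarith
    rw [h4]
    simp [hg0]
  let m1 : C(K, Fin r → TvE) := ⟨fun x => H1 (1, x), by fun_prop⟩
  let m2 : C(K, Fin r → TvE) := ⟨fun x => H2 (1, x), by fun_prop⟩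
  let m3 : C(K, Fin r → TvE) := ⟨fun x => H3 (1, x), by fun_prop⟩
  let m4 : C(K, Fin r → TvE) := ⟨fun x => H4 (1, x), by fun_prop⟩
  have T1 : ContinuousMap.HomotopicWith f0 m1 (TvP ∅ b) := by
    refine tv_homotopic _ _ _ _ H1 hH1 (fun x => ?_) (fun x => rfl) hn1 (by simp)
    rw [hf0]; simp [H1, tvPhi, D]
  have T2 : ContinuousMap.HomotopicWith m1 m2 (TvP ∅ b) := by
    refine tv_homotopic _ _ _ _ H2 hH2 (fun x => ?_) (fun x => rfl) hn2 (by simp)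
    simp [H1, H2, m1]
  have T3 : ContinuousMap.HomotopicWith m2 m3 (TvP ∅ b) := by
    refine tv_homotopic _ _ _ _ H3 hH3 (fun x => ?_) (fun x => rfl) hn3 (by simp)
    simp [H2, H3, m2]
  have T4 : ContinuousMap.HomotopicWith m3 m4 (TvP ∅ b) := by
    refine tv_homotopic _ _ _ _ H4 hH4 (fun x => ?_) (fun x => rfl) hn4 (by simp)
    simp only [H3, H4, m3, ContinuousMap.coe_mk, sub_self, zero_smul, zero_add, one_smul]
    congr 2
    obtain ⟨J, hJ, hJu⟩ := hDu (tvF a x)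
    rw [Finset.sum_eq_single_of_mem J hJ]
    · by_cases hf : tvF a x = 0
      · simp [hf, D, tvD]
      · have h0 : tvcl 0 = 0 := by simp [tvcl]
        have hU0 : U (0, x) = tvnz (tvp η (tvF a x / aJ J)) ^ w J.card := by
          simp only [U]
          rw [Finset.prod_eq_single_of_mem J hJ]
          · simp [h0]
          · intro J' hJ' hne
            have h5 := hJu J' hJ' hne
            simp only [D, tvD] at h5
            have h6 : tvF a x / aJ J' ≠ 0 := div_ne_zero hf (haJ J' hJ')
            have h7 : tvnz (tvp η (tvF a x / aJ J')) ^ w J'.card = 1 := by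
              apply mul_left_cancel₀ h6
              rw [mul_one]; exact sub_eq_zero.1 h5
            simpa [h0] using h7
        rw [hU0]
        simp only [D, tvD]
        have := haJ J hJ
        field_simp
    · intro J' hJ' hne
      rw [hJu J' hJ' hne, mul_zero]
  have T5 : ContinuousMap.HomotopicWith m4 (ContinuousMap.const _ (g u0)) (TvP ∅ b) := by
    refine tv_homotopic _ _ _ _ H5 hH5 (fun x => ?_) (fun x => ?_) hn5 (by simp)
    · simp only [H4, H5, m4, ContinuousMap.coe_mk, hUend]
      have : u0 * (‖tvF a x‖ : ℂ) = (u0 * (‖tvF a x‖ : ℂ) - tvF a x) + tvF a x := by ring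
      simp only [sub_zero, one_smul, one_mul, add_zero]
      rw [this, hgadd, ← this]
      abel
    · simp [H5]
  refine ⟨g u0, ?_, T1.trans (T2.trans (T3.trans (T4.trans T5)))⟩
  rcases tvNC_or hr (g u0) with h | ⟨κ, hκ⟩
  · exact h
  · exact absurd ((hgF u0).symm.trans (tvF_const a ha _ κ hκ)) hu0

theorem tv_part3 {r : ℕ} (hr : 2 ≤ r) (hnp : ¬ IsPrimePow r) (K K2 : Set (Fin r → TvE))
    (hKc : IsCompact K) (hK2c : IsCompact K2) (hK : ∀ x ∈ K, TvNC x)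
    (hK2 : ∀ x ∈ K2, ∀ J : Finset (Fin r), ∀ κ : TvE, ∀ ρ : ℝ,
      ¬ ∀ i, x i = κ + (if i ∈ J then ρ else 0) • ((1, 0) : TvE)) :
    ∃ φ : C(Fin r → TvE, Fin r → TvE), (∀ x (σ : Equiv.Perm (Fin r)), φ (x ∘ σ) = φ x ∘ σ) ∧
      (∀ x ∈ K2, φ x = x) ∧ ∃ c' : Fin r → TvE, TvNC c' ∧ ∀ b,
      ContinuousMap.HomotopicWith (φ.restrict K) (ContinuousMap.const _ c') (TvP ∅ b) := by
  obtain ⟨w, hw⟩ := tv_weights hr hnp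
  obtain ⟨a, ha, ha0, ha1⟩ := tv_functional hr
  obtain ⟨η1, hη1, hη1'⟩ := tv_eta_f a ha0 ha1
  obtain ⟨δ, hδ, η0, hη0, hid⟩ := tv_id_params K2 hK2c (by
    intro x hx J hJ κ ρ hρ h
    refine hK2 x hx J κ ρ fun i => ?_
    rw [h i]
    unfold tvI
    split_ifs <;> simp)
  have : CompactSpace K := isCompact_iff_compactSpace.1 hKc
  obtain ⟨c0, hc0, hc0K⟩ := tv_exists_lower (fun x : K => tvN x.1)
    (tvN_continuous.comp continuous_subtype_val) (fun x => tvN_pos.2 (hK x x.2))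
  set c := c0 / 4 with hc
  have hcp : 0 < c := by positivity
  set ε := min δ (c / 2) with hε
  have hεp : 0 < ε := lt_min hδ (by positivity)
  set η := min (1 / 2) (min η0 η1) with hη
  have hηp : 0 < η := lt_min (by norm_num) (lt_min hη0 hη1)
  have hη2 : η ≤ 1 / 2 := min_le_left _ _
  refine ⟨⟨tvPhi ε c η w, tvPhi_cont ε c hηp w⟩, fun x σ => tvPhi_perm ε c η w x σ, ?_, ?_⟩
  · intro x hx
    exact hid ε c η hεp (min_le_left _ _) hcp hηp ((min_le_right _ _).trans (min_le_left _ _)) w x hx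
  · have key := fun b => tv_null hr w hw a ha ha0 K ε c η hεp hcp
      (by have := min_le_right δ (c / 2); rw [← hε] at this; linarith) hηp hη2
      (fun x hx => by have := hc0K ⟨x, hx⟩; simp only at this; linarith)
      (hη1' η hηp ((min_le_right _ _).trans (min_le_right _ _)) hη2) b
      (ContinuousMap.restrict K ⟨tvPhi ε c η w, tvPhi_cont ε c hηp w⟩) (fun x => rfl)
    obtain ⟨c', hc', h⟩ := key (fun _ => 0)
    refine ⟨c', hc', fun b => ?_⟩
    have e : TvP (X := K) (r := r) ∅ b = TvP ∅ (fun _ => 0) := by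
      funext h; simp [TvP]
    rw [e]; exact h

end TvPartM

section TvPartN
open Set Filter Topology

/-! Part 5: assembly -/

theorem tv_sep {r : ℕ} {Pp A κ : Type} (l : Pp → Fin r → A) (ix : A → Fin r)
    (hix : ∀ p j, ix (l p j) = j) (cs : κ → A → Fin r) (P : Pp → κ → Equiv.Perm (Fin r))
    (h : ∀ p k j, cs k (l p j) = P p k j) (hsep : ∀ p q, (∀ k, P p k = P q k) → p = q) :
    (∀ p, Function.Injective (l p)) ∧
    ∀ p q, p ≠ q → ∃ j j', l p j ≠ l p j' ∧ l p j ∉ range (l q) ∧ l p j' ∉ range (l q) := by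
  have hinj : ∀ p, Function.Injective (l p) := fun p =>
    Function.LeftInverse.injective (g := ix) (hix p)
  refine ⟨hinj, fun p q hpq => ?_⟩
  have : ∃ k, P p k ≠ P q k := by
    by_contra hn
    push Not at hn
    exact hpq (hsep p q hn)
  obtain ⟨k, hk⟩ := this
  have h1 : ∃ j, P p k j ≠ P q k j := by
    by_contra hn
    push Not at hn
    exact hk (Equiv.ext hn)
  obtain ⟨j, hj⟩ := h1
  have hnot : ∀ j, P p k j ≠ P q k j → l p j ∉ range (l q) := by
    rintro j hj ⟨j', hj'⟩
    have e := congrArg ix hj'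
    rw [hix, hix] at e
    subst e
    apply hj
    rw [← h, ← h, hj']
  let j' := (P p k)⁻¹ (P q k j)
  have hj' : P p k j' = P q k j := by simp [j']
  have hne : j ≠ j' := by
    intro e
    rw [← e] at hj'
    exact hj hj'
  refine ⟨j, j', fun e => hne (hinj p e), hnot j hj, hnot j' ?_⟩
  rw [hj']
  exact fun e => hne ((P q k).injective e)

theorem tv_glue {T E Y C : Type} [TopologicalSpace T] [TopologicalSpace E] [TopologicalSpace Y]
    [Finite C] (D : C → Set E) (hD : ∀ c, IsClosed (D c)) (B : Set E) (hB : B = ⋃ c, D c)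
    (h : ∀ c, C(T × D c, Y))
    (hag : ∀ c c' t (ht : t ∈ D c) (ht' : t ∈ D c') s, h c (s, ⟨t, ht⟩) = h c' (s, ⟨t, ht'⟩)) :
    ∃ H : C(T × B, Y), ∀ c (t : B) (ht : t.1 ∈ D c) s, H (s, t) = h c (s, ⟨t.1, ht⟩) := by
  classical
  have hex : ∀ t : B, ∃ c, t.1 ∈ D c := by
    rintro ⟨t, ht⟩
    rw [hB, mem_iUnion] at ht
    exact ht
  choose ch hch using hex
  let H : T × B → Y := fun p => h (ch p.2) (p.1, ⟨p.2.1, hch p.2⟩)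
  have hH : ∀ c (t : B) (ht : t.1 ∈ D c) s, H (s, t) = h c (s, ⟨t.1, ht⟩) := fun c t ht s =>
    hag _ _ _ _ _ _
  refine ⟨⟨H, ?_⟩, hH⟩
  let f : C → Set (T × B) := fun c => {p | p.2.1 ∈ D c}
  refine (locallyFinite_of_finite f).continuous ?_ ?_ ?_
  · ext p
    simp only [f, mem_iUnion, mem_ofPred_eq, mem_univ, iff_true]
    exact ⟨_, hch p.2⟩
  · intro c
    exact (hD c).preimage (continuous_subtype_val.comp continuous_snd)
  · intro c
    rw [continuousOn_iff_continuous_domRestrict]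
    have : (f c).domRestrict H = fun p : f c => h c (p.1.1, ⟨p.1.2.1, p.2⟩) := by
      funext p
      exact hH c p.1.2 p.2 p.1.1
    rw [this]
    fun_prop

theorem tv_raw {r : ℕ} {X : Type} [TopologicalSpace X] {Bd : Set X} {b : X → Fin r → TvE}
    {f g : C(X, Fin r → TvE)} (h : ContinuousMap.HomotopicWith f g (TvP Bd b)) :
    ∃ H : C(unitInterval × X, Fin r → TvE), (∀ x, H (0, x) = f x) ∧ (∀ x, H (1, x) = g x) ∧
      (∀ s x, TvNC (H (s, x))) ∧ ∀ s, ∀ x ∈ Bd, H (s, x) = b x := by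
  obtain ⟨F⟩ := h
  refine ⟨F.toHomotopy.toContinuousMap, fun x => F.toHomotopy.apply_zero x,
    fun x => F.toHomotopy.apply_one x, fun s x => (F.prop' s).1 x, fun s x hx => (F.prop' s).2 x hx⟩

theorem tv_unraw {r : ℕ} {X : Type} [TopologicalSpace X] {Bd : Set X} {b : X → Fin r → TvE}
    {f g : C(X, Fin r → TvE)}
    (H : C(unitInterval × X, Fin r → TvE)) (h0 : ∀ x, H (0, x) = f x) (h1 : ∀ x, H (1, x) = g x)
    (hn : ∀ s x, TvNC (H (s, x))) (hb : ∀ s, ∀ x ∈ Bd, H (s, x) = b x) :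
    ContinuousMap.HomotopicWith f g (TvP Bd b) :=
  ⟨⟨⟨H, h0, h1⟩, fun s => ⟨fun x => hn s x, fun x hx => hb s x hx⟩⟩⟩

theorem tvNC_perm {r : ℕ} {x : Fin r → TvE} (h : TvNC x) (σ : Equiv.Perm (Fin r)) :
    TvNC (x ∘ σ) := by
  rw [← tvN_pos, tvN_perm, tvN_pos]; exact h

/-- the linear start map -/
noncomputable def tvh0 {r : ℕ} {C : Type} [Fintype C] (w : C × Fin r → TvE) (a : C → Fin r)
    (t : stdSimplex ℝ C) : TvE := ∑ c, t.1 c • w (c, a c)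

theorem tvh0_cont {r : ℕ} {C : Type} [Fintype C] (w : C × Fin r → TvE) (a : C → Fin r) :
    Continuous (tvh0 w a) := by
  unfold tvh0
  have : ∀ c, Continuous fun t : stdSimplex ℝ C => t.1 c := fun c =>
    (continuous_apply c).comp continuous_subtype_val
  exact continuous_finsetSum _ fun c _ => (this c).smul continuous_const

theorem tvh0_congr {r : ℕ} {C : Type} [Fintype C] (w : C × Fin r → TvE) (a b : C → Fin r)
    (t : stdSimplex ℝ C) (h : ∀ c, t.1 c ≠ 0 → a c = b c) : tvh0 w a t = tvh0 w b t := by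
  unfold tvh0
  refine Finset.sum_congr rfl fun c _ => ?_
  by_cases hc : t.1 c = 0
  · simp [hc]
  · rw [h c hc]

theorem tv_face {r : ℕ} {C : Type} [Fintype C] [DecidableEq C] (hC : Fintype.card C + 1 < 3 * r)
    (z0 : Fin r) (w : C × Fin r → TvE) (φ : C(Fin r → TvE, Fin r → TvE))
    (hφ : ∀ x (σ : Equiv.Perm (Fin r)), φ (x ∘ σ) = φ x ∘ σ)
    (c c' : C) (hcc : c' ≠ c)
    (hn : ∀ (t : stdSimplex ℝ C), t.1 c = 0 → ∀ π : C → Equiv.Perm (Fin r),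
      TvNC (φ fun i => tvh0 w (fun c => π c i) t))
    (hid : ∀ (t : stdSimplex ℝ C), t.1 c = 0 → (∃ d, d ≠ c ∧ t.1 d = 0) →
      ∀ π : C → Equiv.Perm (Fin r),
      (φ fun i => tvh0 w (fun c => π c i) t) = fun i => tvh0 w (fun c => π c i) t) :
    ∃ y : C({t : stdSimplex ℝ C | t.1 c = 0}, (C → Fin r) → TvE),
      (∀ t, (∃ d, d ≠ c ∧ t.1.1 d = 0) → ∀ a, y t a = tvh0 w a t) ∧
      ∀ π : C → Equiv.Perm (Fin r), ∃ H : C(unitInterval × {t : stdSimplex ℝ C | t.1 c = 0}, Fin r → TvE),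
        (∀ t i, H (0, t) i = y t (Function.update (fun c => π c i) c z0)) ∧
        (∀ t, H (1, t) = φ fun i => tvh0 w (fun c => π c i) t) ∧
        (∀ s t, TvNC (H (s, t))) ∧
        ∀ s t, (∃ d, d ≠ c ∧ t.1.1 d = 0) → ∀ i, H (s, t) i = tvh0 w (fun c => π c i) t := by
  classical
  let X : Set (stdSimplex ℝ C) := {t | t.1 c = 0}
  have hcoord : ∀ c, Continuous fun t : stdSimplex ℝ C => t.1 c := fun c =>
    (continuous_apply c).comp continuous_subtype_val
  have hXc : IsClosed X := isClosed_eq (hcoord c) continuous_const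
  have : CompactSpace (stdSimplex ℝ C) := isCompact_iff_compactSpace.1 (isCompact_stdSimplex ℝ C)
  have : CompactSpace X := isCompact_iff_compactSpace.1 hXc.isCompact
  let Bd : Set X := {t | ∃ d, d ≠ c ∧ t.1.1 d = 0}
  have hBd : IsClosed Bd := by
    have : Bd = ⋃ d : C, {t : X | d ≠ c ∧ t.1.1 d = 0} := by ext t; simp [Bd]
    rw [this]
    refine isClosed_iUnion_of_finite fun d => ?_
    by_cases hd : d = c
    · simp [hd]
    · simp only [ne_eq, hd, not_false_eq_true, true_and]
      exact isClosed_eq ((hcoord d).comp continuous_subtype_val) continuous_const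
  let Pp := {π : C → Equiv.Perm (Fin r) // π c' = 1 ∧ π c = 1}
  let l : Pp → Fin r → (C → Fin r) := fun π i => Function.update (fun c => π.1 c i) c z0
  obtain ⟨hL, hl⟩ := tv_sep (κ := {d : C // d ≠ c}) l (fun a => a c')
    (fun p j => by simp [l, hcc, p.2.1]) (fun d a => a d.1) (fun p d => p.1 d.1)
    (fun p k j => by simp [l, k.2]) (by
      intro p q h
      apply Subtype.ext
      funext d
      by_cases hd : d = c
      · rw [hd, p.2.2, q.2.2]
      · exact h ⟨d, hd⟩)
  let y0 : C(X, (C → Fin r) → TvE) := ⟨fun t a => tvh0 w a t.1,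
    continuous_pi fun a => (tvh0_cont w a).comp continuous_subtype_val⟩
  let G0 : (C → Equiv.Perm (Fin r)) → C(X, Fin r → TvE) := fun π =>
    ⟨fun t => φ fun i => tvh0 w (fun c => π c i) t.1, φ.continuous.comp
      (continuous_pi fun i => (tvh0_cont w _).comp continuous_subtype_val)⟩
  obtain ⟨y, hy, hyH⟩ := tv_combination (X := X) (W := C → ℝ) (A := C → Fin r) (Pp := Pp)
    (by rw [Module.finrank_fintype_fun_eq_card]; exact hC) (fun t => t.1.1) (by fun_prop)
    (fun s t h => Subtype.ext (Subtype.ext h)) Bd hBd l hL hl y0 (fun π => G0 π.1)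
    (fun p x => hn x.1 x.2 p.1) (by
      intro p x hx
      have h1 := hid x.1 x.2 hx p.1
      simp only [G0, ContinuousMap.coe_mk]
      rw [h1]
      funext i
      simp only [tvPre, y0, l, ContinuousMap.coe_mk]
      refine tvh0_congr w _ _ _ fun d hd => ?_
      rw [Function.update_of_ne]
      rintro rfl
      exact hd x.2)
  refine ⟨y, fun t ht a => by rw [hy t ht]; rfl, fun π => ?_⟩
  let ρ := π c'
  let π' : Pp := ⟨fun d => if d = c then 1 else π d * ρ⁻¹, by simp [hcc, ρ], by simp⟩
  have hπ' : ∀ d, d ≠ c → ∀ i, π d i = π'.1 d (ρ i) := by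
    intro d hd i
    simp [π', hd]
  have hF : ∀ t : X, (fun i => tvh0 w (fun c => π c i) t.1) =
      (fun i => tvh0 w (fun c => π'.1 c i) t.1) ∘ ρ := by
    intro t
    funext i
    refine tvh0_congr w _ _ _ fun d hd => hπ' d ?_ i
    rintro rfl
    exact hd t.2
  obtain ⟨H, H0, H1, Hn, Hb⟩ := tv_raw (hyH π')
  refine ⟨⟨fun p => H p ∘ ρ, by fun_prop⟩, ?_, ?_, ?_, ?_⟩
  · intro t i
    simp only [ContinuousMap.coe_mk, Function.comp_apply, H0, tvPre, l]
    refine congrArg (y t) ?_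
    funext d
    by_cases hd : d = c
    · subst hd; simp
    · simp [hd, hπ' d hd i]
  · intro t
    rw [hF t, hφ]
    simp only [ContinuousMap.coe_mk, H1]
    rfl
  · intro s t
    exact tvNC_perm (Hn s t) ρ
  · intro s t ht i
    have h1 := hid t.1 t.2 ht π'.1
    have h2 := congrFun (hF t) i
    simp only [ContinuousMap.coe_mk, Function.comp_apply] at h2 ⊢
    rw [h2, Hb s t ht]
    exact congrFun h1 (ρ i)

end TvPartN

section TvPartO
open Set Filter Topology

theorem tv_core {r : ℕ} (hr : 2 ≤ r) (hnp : ¬ IsPrimePow r) {C : Type} [Fintype C] [DecidableEq C]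
    (hC : Fintype.card C + 1 < 3 * r) (hC2 : 2 ≤ Fintype.card C) :
    ∃ h : (C → Fin r) → (C → ℝ) → ℂ × ℝ, (∀ a, ContinuousOn (h a) (stdSimplex ℝ C)) ∧
      (∀ a b, ∀ t ∈ stdSimplex ℝ C, (∀ c, t c ≠ 0 → a c = b c) → h a t = h b t) ∧
      (∀ π : C → Equiv.Perm (Fin r), ∀ t ∈ stdSimplex ℝ C,
        ∃ i j, h (fun c => π c i) t ≠ h (fun c => π c j) t) := by
  classical
  let E := stdSimplex ℝ C
  let z0 : Fin r := ⟨0, by omega⟩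
  obtain ⟨w, hw⟩ := tv_part2 (r := r) hC hC2 (1, 0)
  have hcoord : ∀ c, Continuous fun t : E => t.1 c := fun c =>
    (continuous_apply c).comp continuous_subtype_val
  have hsupp : ∀ t : E, ∃ c, t.1 c ≠ 0 := by
    intro t
    by_contra hn
    push Not at hn
    have := t.2.2
    simp [hn] at this
  have : CompactSpace E := isCompact_iff_compactSpace.1 (isCompact_stdSimplex ℝ C)
  let D : C → Set E := fun c => {t | t.1 c = 0}
  have hD : ∀ c, IsClosed (D c) := fun c => isClosed_eq (hcoord c) continuous_const
  let B : Set E := ⋃ c, D c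
  have hB : IsClosed B := isClosed_iUnion_of_finite hD
  let B2 : Set E := ⋃ p : {p : C × C // p.1 ≠ p.2}, D p.1.1 ∩ D p.1.2
  have hB2 : IsClosed B2 := isClosed_iUnion_of_finite fun p => (hD _).inter (hD _)
  let F : (C → Equiv.Perm (Fin r)) → E → Fin r → TvE := fun π t i => tvh0 w (fun c => π c i) t
  have hF : ∀ π, Continuous (F π) := fun π => continuous_pi fun i => tvh0_cont w _
  let K : Set (Fin r → TvE) := ⋃ π, F π '' B
  let K2 : Set (Fin r → TvE) := ⋃ π, F π '' B2
  have hK : IsCompact K := isCompact_iUnion fun π => hB.isCompact.image (hF π)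
  have hK2 : IsCompact K2 := isCompact_iUnion fun π => hB2.isCompact.image (hF π)
  have hKn : ∀ x ∈ K, TvNC x := by
    intro x hx
    obtain ⟨π, t, ht, rfl⟩ := mem_iUnion.1 hx
    obtain ⟨c, hc⟩ := mem_iUnion.1 ht
    obtain ⟨c1, hc1⟩ := hsupp t
    rcases tvNC_or hr (F π t) with h | ⟨κ, hκ⟩
    · exact h
    · exfalso
      refine hw π ∅ (fun o => o.elim 0 t.1) κ c1 none (some c) hc1 (by simp) rfl hc fun i => ?_
      have := hκ i
      simp only [F, tvh0] at this
      simpa using this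
  have hK2n : ∀ x ∈ K2, ∀ J : Finset (Fin r), ∀ κ : TvE, ∀ ρ : ℝ,
      ¬ ∀ i, x i = κ + (if i ∈ J then ρ else 0) • ((1, 0) : TvE) := by
    intro x hx J κ ρ h
    obtain ⟨π, t, ht, rfl⟩ := mem_iUnion.1 hx
    obtain ⟨⟨⟨c, c'⟩, hne⟩, hc, hc'⟩ := mem_iUnion.1 ht
    obtain ⟨c1, hc1⟩ := hsupp t
    refine hw π J (fun o => o.elim ρ t.1) κ c1 (some c) (some c') hc1 (by simpa using hne) hc hc' fun i => ?_
    have := h i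
    simp only [F, tvh0] at this
    simpa using this
  obtain ⟨φ, hφ, hφid, c', hc', hφnull⟩ := tv_part3 hr hnp K K2 hK hK2 hKn hK2n
  obtain ⟨HK, HK0, HK1, HKn, -⟩ := tv_raw (hφnull fun _ => 0)
  have hKmem : ∀ π, ∀ t ∈ B, F π t ∈ K := fun π t ht => mem_iUnion.2 ⟨π, t, ht, rfl⟩
  have hDB : ∀ c, ∀ t ∈ D c, t ∈ B := fun c t ht => mem_iUnion.2 ⟨c, ht⟩
  have hφn : ∀ π, ∀ t ∈ B, TvNC (φ (F π t)) := by
    intro π t ht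
    have h1 := HK0 ⟨F π t, hKmem π t ht⟩
    have h2 := HKn 0 ⟨F π t, hKmem π t ht⟩
    rw [h1] at h2
    exact h2
  have hface : ∀ c, ∃ y : C(D c, (C → Fin r) → TvE),
      (∀ t, (∃ d, d ≠ c ∧ t.1.1 d = 0) → ∀ a, y t a = tvh0 w a t) ∧
      ∀ π : C → Equiv.Perm (Fin r), ∃ H : C(unitInterval × D c, Fin r → TvE),
        (∀ t i, H (0, t) i = y t (Function.update (fun c => π c i) c z0)) ∧
        (∀ t, H (1, t) = φ fun i => tvh0 w (fun c => π c i) t) ∧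
        (∀ s t, TvNC (H (s, t))) ∧
        ∀ s t, (∃ d, d ≠ c ∧ t.1.1 d = 0) → ∀ i, H (s, t) i = tvh0 w (fun c => π c i) t := by
    intro c
    obtain ⟨d, hd⟩ := Fintype.exists_ne_of_one_lt_card (by omega : 1 < Fintype.card C) c
    refine tv_face hC z0 w φ hφ c d hd ?_ ?_
    · intro t ht π
      exact hφn π t (hDB c t ht)
    · rintro t ht ⟨d, hd, hd0⟩ π
      exact hφid (F π t) (mem_iUnion.2 ⟨π, t, mem_iUnion.2 ⟨⟨(c, d), hd.symm⟩, ht, hd0⟩, rfl⟩)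
  choose yc hyc HC hHC0 hHC1 hHCn hHCb using hface
  have hupd : ∀ c (t : E) (_ : t ∈ D c) (a : C → Fin r), tvh0 w (Function.update a c z0) t = tvh0 w a t := by
    intro c t ht a
    refine tvh0_congr w _ _ _ fun d hd => ?_
    rw [Function.update_of_ne]
    rintro rfl
    exact hd ht
  -- glue the vertex data
  obtain ⟨yb', hyb'⟩ := tv_glue (T := Unit) D hD B rfl
    (fun c => (⟨fun p a => yc c p.2 (Function.update a c z0), by fun_prop⟩ :
      C(Unit × D c, (C → Fin r) → TvE))) (by
      intro c d t ht ht' s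
      by_cases hcd : c = d
      · subst hcd; rfl
      · funext a
        simp only [ContinuousMap.coe_mk]
        rw [hyc c ⟨t, ht⟩ ⟨d, Ne.symm hcd, ht'⟩, hyc d ⟨t, ht'⟩ ⟨c, hcd, ht⟩]
        exact (hupd c t ht a).trans (hupd d t ht' a).symm)
  let yb : C(B, (C → Fin r) → TvE) := ⟨fun t => yb' ((), t), by fun_prop⟩
  have hyb : ∀ c (t : B) (ht : t.1 ∈ D c) a, yb t a = yc c ⟨t.1, ht⟩ (Function.update a c z0) :=
    fun c t ht a => congrFun (hyb' c t ht ()) a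
  -- glue the homotopies and extend
  have hG : ∀ π : C → Equiv.Perm (Fin r), ∃ g : C(E, Fin r → TvE), (∀ x, TvNC (g x)) ∧
      ∀ x : B, g x = fun i => yb x (fun c => π c i) := by
    intro π
    obtain ⟨Hb, hHb⟩ := tv_glue (T := unitInterval) D hD B rfl (fun c => HC c π) (by
      intro c d t ht ht' s
      by_cases hcd : c = d
      · subst hcd; rfl
      · funext i
        rw [hHCb c π s ⟨t, ht⟩ ⟨d, Ne.symm hcd, ht'⟩, hHCb d π s ⟨t, ht'⟩ ⟨c, hcd, ht⟩])
    have hBex : ∀ t : B, ∃ c, t.1 ∈ D c := fun t => mem_iUnion.1 t.2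
    let f : C(B, Fin r → TvE) := ⟨fun t i => yb t (fun c => π c i), by fun_prop⟩
    let m : C(B, Fin r → TvE) := ⟨fun t => φ (F π t), φ.continuous.comp ((hF π).comp continuous_subtype_val)⟩
    have T1 : ContinuousMap.HomotopicWith f m (TvP ∅ (fun _ => 0)) := by
      refine tv_unraw Hb ?_ ?_ ?_ (by simp)
      · intro t
        obtain ⟨c, hc⟩ := hBex t
        rw [hHb c t hc]
        funext i
        rw [hHC0]
        exact (hyb c t hc _).symm
      · intro t
        obtain ⟨c, hc⟩ := hBex t
        rw [hHb c t hc, hHC1]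
        rfl
      · intro s t
        obtain ⟨c, hc⟩ := hBex t
        rw [hHb c t hc]
        exact hHCn _ _ _ _
    have T2 : ContinuousMap.HomotopicWith m (ContinuousMap.const _ c') (TvP ∅ (fun _ => 0)) := by
      let q : C(B, K) := ⟨fun t => ⟨F π t, hKmem π t t.2⟩, ((hF π).comp continuous_subtype_val).subtype_mk _⟩
      refine tv_unraw ⟨fun p => HK (p.1, q p.2), by fun_prop⟩ ?_ ?_ ?_ (by simp)
      · intro t; exact HK0 _
      · intro t; exact HK1 _
      · intro s t; exact HKn _ _
    obtain ⟨g, hg, hg2⟩ := tv_hep B hB f c' _ (T1.trans T2) hc'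
    exact ⟨g, hg, fun x => hg2 x⟩
  choose G hGn hGb using hG
  obtain ⟨y0, hy0⟩ := ContinuousMap.exists_extension' hB.isClosedEmbedding_subtypeVal yb
  have hy0' : ∀ x : B, y0 x = yb x := fun x => congrFun hy0 x
  have hne : Nonempty C := Fintype.card_pos_iff.1 (by omega)
  obtain ⟨c0⟩ := hne
  let Pp := {π : C → Equiv.Perm (Fin r) // π c0 = 1}
  let l : Pp → Fin r → (C → Fin r) := fun π i c => π.1 c i
  obtain ⟨hL, hl⟩ := tv_sep (κ := C) l (fun a => a c0)
    (fun p j => by simp [l, p.2]) (fun d a => a d) (fun p d => p.1 d)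
    (fun p k j => rfl) (fun p q h => Subtype.ext (funext h))
  obtain ⟨y, hy, hyH⟩ := tv_combination (X := E) (W := C → ℝ) (A := C → Fin r) (Pp := Pp)
    (by rw [Module.finrank_fintype_fun_eq_card]; exact hC) (fun t => t.1) (by fun_prop)
    (fun s t h => Subtype.ext h) B hB l hL hl y0 (fun π => G π.1)
    (fun p x => hGn p.1 x) (by
      intro p x hx
      rw [hGb p.1 ⟨x, hx⟩]
      funext i
      exact (congrFun (hy0' ⟨x, hx⟩) _).symm)
  have hyB : ∀ c (t : E) (ht : t ∈ D c) a, y t a = yc c ⟨t, ht⟩ (Function.update a c z0) := by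
    intro c t ht a
    rw [hy t (hDB c t ht), hy0' ⟨t, hDB c t ht⟩]
    exact hyb c _ ht a
  refine ⟨fun a t => if ht : t ∈ E then y ⟨t, ht⟩ a else 0, ?_, ?_, ?_⟩
  · intro a
    rw [continuousOn_iff_continuous_domRestrict]
    have : (stdSimplex ℝ C).domRestrict (fun t => if ht : t ∈ E then y ⟨t, ht⟩ a else 0) =
        fun t : E => y t a := by
      funext t
      have ht : t.1 ∈ E := t.2
      simp only [Set.domRestrict_apply, ht, dif_pos]
      rfl
    rw [this]
    fun_prop
  · intro a b t ht hab
    have ht' : t ∈ E := ht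
    simp only [ht', dif_pos]
    by_cases h : ∃ c, t c = 0
    · obtain ⟨c, hc⟩ := h
      have hcD : (⟨t, ht⟩ : E) ∈ D c := hc
      rw [hyB c _ hcD, hyB c _ hcD]
      by_cases h2 : ∃ d, d ≠ c ∧ t d = 0
      · rw [hyc c ⟨⟨t, ht⟩, hcD⟩ h2, hyc c ⟨⟨t, ht⟩, hcD⟩ h2]
        refine (hupd c _ hcD a).trans (Eq.trans ?_ (hupd c _ hcD b).symm)
        exact tvh0_congr w _ _ _ hab
      · push Not at h2
        refine congrArg (yc c ⟨⟨t, ht⟩, hcD⟩) ?_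
        funext d
        by_cases hd : d = c
        · subst hd; simp
        · simp [hd, hab d (h2 d hd)]
    · push Not at h
      rw [show a = b from funext fun c => hab c (h c)]
  · intro π t ht
    have ht' : t ∈ E := ht
    simp only [ht', dif_pos]
    let π' : Pp := ⟨fun c => π c * (π c0)⁻¹, by simp⟩
    obtain ⟨H, H0, -, Hn, -⟩ := tv_raw (hyH π')
    have h1 := Hn 0 ⟨t, ht⟩
    rw [H0] at h1
    obtain ⟨i, j, hij⟩ := tvNC_perm h1 (π c0)
    refine ⟨i, j, ?_⟩
    simpa [tvPre, l, π'] using hij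

theorem tv_final (r : ℕ) (hr : 6 ≤ r) (hnp : ¬ IsPrimePow r)
    (N : ℕ) (hN : N = (3 * r + 1) * (r - 1)) :
    ∃ f : (Fin (N + 1) → ℝ) → EuclideanSpace ℝ (Fin (3 * r)),
      ContinuousOn f (stdSimplex ℝ (Fin (N + 1))) ∧
      ¬ ∃ x : Fin r → (Fin (N + 1) → ℝ),
          (∀ i, x i ∈ stdSimplex ℝ (Fin (N + 1))) ∧
          (Pairwise fun i j => Disjoint {a | 0 < x i a} {a | 0 < x j a}) ∧
          (∀ i j, f (x i) = f (x j)) :=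
  tv_reduction r hr (tv_core (by omega) hnp (by rw [Fintype.card_fin]; omega)
    (by rw [Fintype.card_fin]; omega)) N hN

end TvPartO
open Set

/-- counterexamples to the topological Tverberg conjecture in
dimension `3r`: for `r ≥ 6` not a prime power and `N = (3r+1)(r-1)`, there is a
continuous map `f : σ^N → ℝ^{3r}` with no `r`-Tverberg point, i.e. no `r` points of the
simplex with pairwise disjoint supports have the same image. -/
theorem statement2 (r : ℕ) (hr : 6 ≤ r) (hnp : ¬ IsPrimePow r)
    (N : ℕ) (hN : N = (3 * r + 1) * (r - 1)) :
    ∃ f : (Fin (N + 1) → ℝ) → EuclideanSpace ℝ (Fin (3 * r)),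
      ContinuousOn f (stdSimplex ℝ (Fin (N + 1))) ∧
      ¬ ∃ x : Fin r → (Fin (N + 1) → ℝ),
          (∀ i, x i ∈ stdSimplex ℝ (Fin (N + 1))) ∧
          (Pairwise fun i j => Disjoint {a | 0 < x i a} {a | 0 < x j a}) ∧
          (∀ i j, f (x i) = f (x j)) := by
  exact tv_final r hr hnp N hN
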